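/- Let T > 0, let φ : ℝ → ℝ be continuous and nondecreasing, and let μ be a Lévy measure on ℝ^N \ {0}. Let u, û ∈ L^∞(Q_T) satisfy u − û ∈ L¹(Q_T) and suppose that for every test function ψ ∈ C_c^∞(ℝ^N × [0,T)) one has ∫₀^T ∫_{ℝ^N} [ (u(x,t) − û(x,t)) ∂_t ψ(x,t) + (φ(u(x,t)) − φ(û(x,t))) L^μ[ψ(·,t)](x) ] dx dt = 0 (this encodes that u and û solve ∂_t v − L^μ[φ(v)] = 0 in the sense of distributions in Q_T with the same distributional initial trace). Then u = û a.e. in Q_T. -/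

import Mathlib

open MeasureTheory Set Filter

noncomputable section

/-- Euclidean space `ℝ^N`. -/
abbrev Euc (N : ℕ) := EuclideanSpace ℝ (Fin N)

variable {N : ℕ}

/-- `μ` is a (symmetric) Lévy measure on `ℝ^N ∖ {0}` : it is a nonnegative measure giving no
mass to `{0}`, symmetric (`μ(−B) = μ(B)`), and `∫ min(|z|²,1) dμ(z) < ∞`. -/
def IsLevyMeasure (μ : Measure (Euc N)) : Prop :=
  μ {0} = 0 ∧ μ.map (fun z => -z) = μ ∧
    ∫⁻ z, ENNReal.ofReal (min (‖z‖ ^ 2) 1) ∂μ ≠ ⊤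

/-- The nonlocal operator
`L^μ[ψ](x) = ∫ (ψ(x+z) − ψ(x) − z·Dψ(x) 1_{|z|≤1}) dμ(z)`. -/
def Lop (μ : Measure (Euc N)) (ψ : Euc N → ℝ) (x : Euc N) : ℝ :=
  ∫ z, (ψ (x + z) - ψ x - (if ‖z‖ ≤ 1 then fderiv ℝ ψ x z else 0)) ∂μ

/-- `ψ ∈ C_c^∞(ℝ^N)`. -/
def IsTestFn (ψ : Euc N → ℝ) : Prop :=
  ContDiff ℝ (⊤ : ℕ∞) ψ ∧ HasCompactSupport ψ

/-- `ψ ∈ C_c^∞(ℝ^N × [0,T))` : smooth, compactly supported, and the support stays away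
from `t = T` (but may touch `t = 0`). -/
def IsSTTestFn (T : ℝ) (ψ : Euc N → ℝ → ℝ) : Prop :=
  ContDiff ℝ (⊤ : ℕ∞) (Function.uncurry ψ) ∧ HasCompactSupport (Function.uncurry ψ) ∧
    tsupport (Function.uncurry ψ) ⊆ {p : Euc N × ℝ | p.2 < T}

/-- `ψ ∈ C_c^∞(Q_T)` : smooth, compactly supported inside the open cylinder
`ℝ^N × (0,T)`. -/
def IsIntTestFn (T : ℝ) (ψ : Euc N → ℝ → ℝ) : Prop :=
  ContDiff ℝ (⊤ : ℕ∞) (Function.uncurry ψ) ∧ HasCompactSupport (Function.uncurry ψ) ∧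
    tsupport (Function.uncurry ψ) ⊆ {p : Euc N × ℝ | 0 < p.2 ∧ p.2 < T}

/-- The natural measure on the cylinder `Q_T = ℝ^N × (0,T)`. -/
def QTvol (N : ℕ) (T : ℝ) : Measure (Euc N × ℝ) :=
  (volume : Measure (Euc N)).prod ((volume : Measure ℝ).restrict (Ioo 0 T))

/-- `u ∈ L^∞(Q_T)`. -/
def MemLinfQT (T : ℝ) (u : Euc N → ℝ → ℝ) : Prop :=
  AEStronglyMeasurable (fun p : Euc N × ℝ => u p.1 p.2) (QTvol N T) ∧
    ∃ C : ℝ, ∀ᵐ p ∂(QTvol N T), |u p.1 p.2| ≤ C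

/-- `u ∈ L¹(Q_T)`. -/
def MemL1QT (T : ℝ) (u : Euc N → ℝ → ℝ) : Prop :=
  Integrable (fun p : Euc N × ℝ => u p.1 p.2) (QTvol N T)

/-- `u ∈ C([0,T]; L¹_loc(ℝ^N))` : for every compact `K`, `t ↦ u(·,t)` is continuous
from `[0,T]` into `L¹(K)`. -/
def MemCL1loc (T : ℝ) (u : Euc N → ℝ → ℝ) : Prop :=
  ∀ K : Set (Euc N), IsCompact K →
    (∀ t ∈ Icc (0 : ℝ) T, IntegrableOn (fun x => u x t) K) ∧
    ∀ t ∈ Icc (0 : ℝ) T,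
      Tendsto (fun s => ∫ x in K, |u x s - u x t|) (nhdsWithin t (Icc 0 T)) (nhds 0)

/-- `u` is a distributional solution of `∂_t u − A[φ(u)] = 0` in `Q_T` with initial
datum `u0` : for all `ψ ∈ C_c^∞(ℝ^N × [0,T))`,
`∫₀^T ∫ (u ∂_t ψ + φ(u) A[ψ(·,t)]) dx dt + ∫ u0(x) ψ(x,0) dx = 0`. -/
def IsDistSolOp (T : ℝ) (A : (Euc N → ℝ) → Euc N → ℝ) (φ : ℝ → ℝ)
    (u0 : Euc N → ℝ) (u : Euc N → ℝ → ℝ) : Prop :=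
  ∀ ψ : Euc N → ℝ → ℝ, IsSTTestFn T ψ →
    (∫ t in Ioo (0 : ℝ) T, ∫ x,
        (u x t * deriv (ψ x) t + φ (u x t) * A (fun y => ψ y t) x))
      + ∫ x, u0 x * ψ x 0 = 0

/-- `u0 ∈ L^∞(ℝ^N)`. -/
def MemLinfRn (u0 : Euc N → ℝ) : Prop :=
  AEStronglyMeasurable u0 (volume : Measure (Euc N)) ∧
    ∃ C : ℝ, ∀ᵐ x : Euc N ∂volume, |u0 x| ≤ C

end

theorem integral_mul_primitives_eq {g h : ℝ → ℝ} {T : ℝ}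
    (hg : IntervalIntegrable g volume 0 T) (hh : IntervalIntegrable h volume 0 T) :
    ∫ t in (0 : ℝ)..T, (∫ s in (0 : ℝ)..t, g s) * (∫ s in (0 : ℝ)..t, h s) =
      ∫ t in (0 : ℝ)..T,
        (T - t) * (g t * (∫ s in (0 : ℝ)..t, h s) + (∫ s in (0 : ℝ)..t, g s) * h t) := by
  have hA := hg.absolutelyContinuousOnInterval_intervalIntegral (c := 0) (by simp)
  have hB := hh.absolutelyContinuousOnInterval_intervalIntegral (c := 0) (by simp)
  have hC : AbsolutelyContinuousOnInterval (fun t : ℝ => T - t) 0 T :=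
    ContDiffOn.absolutelyContinuousOnInterval (by fun_prop)
  have key := hC.integral_mul_deriv_eq_deriv_mul (hA.fun_mul hB)
  have hd : ∀ x, deriv (fun t : ℝ => T - t) x = -1 := fun x => by simp
  simp only [hd, sub_self, zero_mul, intervalIntegral.integral_same, mul_zero,
    neg_mul, one_mul, intervalIntegral.integral_neg] at key
  simp only [sub_neg_eq_add, zero_add] at key
  rw [← key]
  apply intervalIntegral.integral_congr_ae
  filter_upwards [hg.ae_hasDerivAt_integral, hh.ae_hasDerivAt_integral] with x h1 h2 h3
  have h4 : x ∈ uIcc 0 T := uIoc_subset_uIcc h3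
  rw [((h1 h4 0 (by simp)).fun_mul (h2 h4 0 (by simp))).deriv]

theorem ae_eq_primitive_of_weak_deriv {w g : ℝ → ℝ} {T : ℝ} (hT : 0 < T)
    (hw : IntegrableOn w (Ioo 0 T)) (hg : IntegrableOn g (Ioo 0 T))
    (hwg : ∀ θ : ℝ → ℝ, ContDiff ℝ (⊤ : ℕ∞) θ → HasCompactSupport θ → tsupport θ ⊆ Iio T →
      ∫ t in Ioo 0 T, (w t * deriv θ t + g t * θ t) = 0) :
    ∀ᵐ t ∂(volume.restrict (Ioo 0 T)), w t = ∫ s in (0 : ℝ)..t, g s := by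
  have hgI : IntervalIntegrable g volume 0 T := by
    rw [intervalIntegrable_iff_integrableOn_Ioo_of_le hT.le]; exact hg
  have hA := hgI.absolutelyContinuousOnInterval_intervalIntegral (c := 0) (by simp)
  have hAc : IntegrableOn (fun t => ∫ s in (0 : ℝ)..t, g s) (Ioo 0 T) := by
    have := hA.continuousOn
    rw [uIcc_of_le hT.le] at this
    exact this.integrableOn_Icc.mono_set Ioo_subset_Icc_self
  rw [ae_restrict_iff' measurableSet_Ioo]
  have main : ∀ᵐ t, t ∈ Ioo 0 T → (w t - ∫ s in (0 : ℝ)..t, g s) = 0 := by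
    refine IsOpen.ae_eq_zero_of_integral_contDiff_smul_eq_zero isOpen_Ioo
      (IntegrableOn.locallyIntegrableOn (hw.sub hAc)) ?_
    intro η hη hηc hηs
    let χ : ContDiffBump (0 : ℝ) := ⟨T, T + 1, hT, by linarith⟩
    have hprim : ∀ t, HasDerivAt (fun t => ∫ s in T..t, η s) (η t) t := fun t =>
      intervalIntegral.integral_hasDerivAt_right (hη.continuous.intervalIntegrable _ _)
        hη.continuous.stronglyMeasurable.stronglyMeasurableAtFilter hη.continuous.continuousAt
    have hpsm : ContDiff ℝ (⊤ : ℕ∞) (fun t => ∫ s in T..t, η s) := by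
      rw [contDiff_infty_iff_deriv]
      refine ⟨fun t => (hprim t).differentiableAt, ?_⟩
      have : deriv (fun t => ∫ s in T..t, η s) = η := funext fun t => (hprim t).deriv
      rw [this]; exact hη
    set θ : ℝ → ℝ := fun t => χ t * ∫ s in T..t, η s with hθ
    have hθsm : ContDiff ℝ (⊤ : ℕ∞) θ := χ.contDiff.mul hpsm
    have hθc : HasCompactSupport θ := χ.hasCompactSupport.mul_right
    obtain ⟨b, hbT, hb⟩ : ∃ b < T, ∀ t ≥ b, η t = 0 := by
      by_cases hne : (tsupport η).Nonempty
      · obtain ⟨b, hb, hmax⟩ := hηc.isCompact.exists_isMaxOn hne continuousOn_id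
        refine ⟨(b + T) / 2, by linarith [(hηs hb).2], fun t ht => ?_⟩
        by_contra h0
        have := hmax (subset_tsupport η h0)
        simp only [id, mem_ofPred_eq] at this
        linarith [(hηs hb).2]
      · refine ⟨T - 1, by linarith, fun t _ => ?_⟩
        by_contra h0
        exact hne ⟨t, subset_tsupport η h0⟩
    have hpz : ∀ t ≥ b, ∫ s in T..t, η s = 0 := by
      intro t ht
      apply intervalIntegral.integral_zero_ae
      refine Eventually.of_forall fun s hs => hb s ?_
      have := uIoc_subset_uIcc hs
      have h2 : min T t ≤ s := this.1
      exact le_trans (le_min hbT.le ht) h2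
    have hθs : tsupport θ ⊆ Iio T := by
      refine subset_trans (closure_minimal ?_ isClosed_Iic) (Iic_subset_Iio.2 hbT)
      intro t ht
      by_contra h0
      simp only [mem_Iic, not_le] at h0
      exact ht (by simp [hθ, hpz t h0.le])
    have hχ1 : ∀ t ∈ Icc 0 T, θ t = ∫ s in T..t, η s := by
      intro t ht
      have : χ t = 1 := χ.one_of_mem_closedBall (by
        simp only [Metric.mem_closedBall, dist_zero_right, Real.norm_eq_abs, χ]
        rw [abs_of_nonneg ht.1]; exact ht.2)
      simp [hθ, this]
    have hderiv : ∀ t ∈ Ioo 0 T, deriv θ t = η t := by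
      intro t ht
      have : θ =ᶠ[nhds t] fun t => ∫ s in T..t, η s := by
        filter_upwards [isOpen_Ioo.mem_nhds ht] with x hx using hχ1 x (Ioo_subset_Icc_self hx)
      rw [this.deriv_eq, (hprim t).deriv]
    have hθac : AbsolutelyContinuousOnInterval θ 0 T :=
      ContDiffOn.absolutelyContinuousOnInterval
        ((hθsm.of_le (by exact_mod_cast le_top)).contDiffOn)
    have ibp := hA.integral_mul_deriv_eq_deriv_mul hθac
    have hθT : θ T = 0 := by simp [hθ]
    simp only [hθT, intervalIntegral.integral_same, mul_zero, zero_mul, sub_zero, zero_sub] at ibp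
    have ibp2 : ∫ t in Ioo 0 T, (∫ s in (0 : ℝ)..t, g s) * η t = - ∫ t in Ioo 0 T, g t * θ t := by
      rw [← integral_Ioc_eq_integral_Ioo, ← integral_Ioc_eq_integral_Ioo,
        ← intervalIntegral.integral_of_le hT.le, ← intervalIntegral.integral_of_le hT.le]
      rw [show (∫ t in (0 : ℝ)..T, g t * θ t) =
        ∫ x in (0 : ℝ)..T, deriv (fun t => ∫ s in (0 : ℝ)..t, g s) x * θ x from ?_]
      · rw [← ibp]
        rw [intervalIntegral.integral_of_le hT.le, intervalIntegral.integral_of_le hT.le,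
          integral_Ioc_eq_integral_Ioo, integral_Ioc_eq_integral_Ioo]
        refine setIntegral_congr_fun measurableSet_Ioo fun t ht => ?_
        simp only [hderiv t ht]
      · apply intervalIntegral.integral_congr_ae
        filter_upwards [hgI.ae_hasDerivAt_integral] with x h1 h3
        rw [(h1 (uIoc_subset_uIcc h3) 0 (by simp)).deriv]
    have hηb : ∃ C, ∀ x, ‖η x‖ ≤ C := hηc.exists_bound_of_continuous hη.continuous
    have hθb : ∃ C, ∀ x, ‖θ x‖ ≤ C := hθc.exists_bound_of_continuous hθsm.continuous
    obtain ⟨C, hC⟩ := hηb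
    obtain ⟨C', hC'⟩ := hθb
    have i1 : IntegrableOn (fun t => w t * η t) (Ioo 0 T) :=
      Integrable.mul_bdd (c := C) hw hη.continuous.aestronglyMeasurable (Eventually.of_forall hC)
    have i2 : IntegrableOn (fun t => (∫ s in (0 : ℝ)..t, g s) * η t) (Ioo 0 T) :=
      Integrable.mul_bdd (c := C) hAc hη.continuous.aestronglyMeasurable (Eventually.of_forall hC)
    have i3 : IntegrableOn (fun t => g t * θ t) (Ioo 0 T) :=
      Integrable.mul_bdd (c := C') hg hθsm.continuous.aestronglyMeasurable (Eventually.of_forall hC')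
    have e1 := hwg θ hθsm hθc hθs
    have e2 : ∫ t in Ioo 0 T, (w t * deriv θ t + g t * θ t) =
        (∫ t in Ioo 0 T, w t * η t) + ∫ t in Ioo 0 T, g t * θ t := by
      rw [← integral_add i1 i3]
      refine setIntegral_congr_fun measurableSet_Ioo fun t ht => ?_
      simp only [hderiv t ht]
    have e3 : ∫ t in Ioo 0 T, η t • (w t - ∫ s in (0 : ℝ)..t, g s) = 0 := by
      have : ∀ t, η t • (w t - ∫ s in (0 : ℝ)..t, g s) =
          w t * η t - (∫ s in (0 : ℝ)..t, g s) * η t := fun t => by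
        simp only [smul_eq_mul]; ring
      simp only [this]
      rw [integral_sub i1 i2, ibp2]
      linarith
    refine Eq.trans (setIntegral_eq_integral_of_forall_compl_eq_zero fun t ht => ?_).symm e3
    have : η t = 0 := by
      by_contra h0
      exact ht (hηs (subset_tsupport η h0))
    simp [this]
  filter_upwards [main] with t ht ht2
  linarith [ht ht2]

/-- Translation of the space variable in `ℝ^N × ℝ`. -/
def spaceShift {N : ℕ} (z : Euc N) (p : Euc N × ℝ) : Euc N × ℝ := (p.1 + z, p.2)

/-- Correlation in the space variable of `f` with the kernel `k` relative to `ν`. -/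
noncomputable def kcorr {N : ℕ} (ν : Measure (Euc N)) (k : Euc N → ℝ) (f : Euc N × ℝ → ℝ)
    (p : Euc N × ℝ) : ℝ :=
  ∫ z, k z * f (spaceShift z p) ∂ν

/-- Correlation in the space variable of `f` with the measure `ν`. -/
noncomputable def corr {N : ℕ} (ν : Measure (Euc N)) (f : Euc N × ℝ → ℝ) (p : Euc N × ℝ) : ℝ :=
  ∫ z, f (spaceShift z p) ∂ν

instance sigmaFinite_QTvol {N : ℕ} {T : ℝ} : SigmaFinite (QTvol N T) := by
  unfold QTvol; infer_instance

section Correlation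

variable {N : ℕ} {T : ℝ} {ν : Measure (Euc N)} {f F : Euc N × ℝ → ℝ} {k : Euc N → ℝ} {C : ℝ}

theorem corr_eq_kcorr : corr ν f = kcorr ν (fun _ => 1) f := by
  funext p; simp [corr, kcorr]

theorem measurable_spaceShift_uncurry :
    Measurable fun q : (Euc N × ℝ) × Euc N => spaceShift q.2 q.1 := by
  unfold spaceShift; fun_prop

theorem measurable_spaceShift (z : Euc N) : Measurable (spaceShift z) := by
  unfold spaceShift; fun_prop

theorem measurable_spaceShift_left (p : Euc N × ℝ) : Measurable fun z => spaceShift z p := by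
  unfold spaceShift; fun_prop

theorem spaceShift_spaceShift (y z : Euc N) (p : Euc N × ℝ) :
    spaceShift y (spaceShift z p) = spaceShift (z + y) p := by
  simp [spaceShift, add_assoc]

theorem measurePreserving_spaceShift (z : Euc N) :
    MeasurePreserving (spaceShift z) (QTvol N T) (QTvol N T) := by
  have h := (measurePreserving_add_right (volume : Measure (Euc N)) z).prod
    (MeasurePreserving.id ((volume : Measure ℝ).restrict (Ioo 0 T)))
  exact h

theorem measurableEmbedding_spaceShift (z : Euc N) : MeasurableEmbedding (spaceShift z) := by
  exact ((MeasurableEquiv.addRight z).prodCongr (MeasurableEquiv.refl ℝ)).measurableEmbedding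

theorem integral_comp_spaceShift (z : Euc N) (f : Euc N × ℝ → ℝ) :
    ∫ p, f (spaceShift z p) ∂(QTvol N T) = ∫ p, f p ∂(QTvol N T) :=
  (measurePreserving_spaceShift z).integral_comp (measurableEmbedding_spaceShift z) f

theorem integrable_comp_spaceShift (z : Euc N) (hf : Integrable f (QTvol N T)) :
    Integrable (fun p => f (spaceShift z p)) (QTvol N T) :=
  (measurePreserving_spaceShift z).integrable_comp_of_integrable hf

theorem measurable_kcorr [SFinite ν] (hk : Measurable k) (hf : Measurable f) :
    Measurable (kcorr ν k f) := by
  have h : StronglyMeasurable fun q : (Euc N × ℝ) × Euc N => k q.2 * f (spaceShift q.2 q.1) :=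
    ((hk.comp measurable_snd).mul (hf.comp measurable_spaceShift_uncurry)).stronglyMeasurable
  exact h.integral_prod_right.measurable

theorem integrable_kernel_mul (hk : Integrable k ν) (hf : Measurable f) (hC : ∀ p, |f p| ≤ C)
    (p : Euc N × ℝ) : Integrable (fun z => k z * f (spaceShift z p)) ν :=
  hk.mul_bdd (c := C) (hf.comp (measurable_spaceShift_left p)).aestronglyMeasurable
    (Eventually.of_forall fun _ => hC _)

theorem abs_kcorr_le (hk : Integrable k ν) (hf : Measurable f) (hC : ∀ p, |f p| ≤ C)
    (p : Euc N × ℝ) : |kcorr ν k f p| ≤ (∫ z, |k z| ∂ν) * C := by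
  unfold kcorr
  rw [← integral_mul_const]
  refine (abs_integral_le_integral_abs).trans
    (integral_mono (integrable_kernel_mul hk hf hC p).abs (hk.abs.mul_const C) fun z => ?_)
  simp only [abs_mul]
  exact mul_le_mul_of_nonneg_left (hC _) (abs_nonneg _)

theorem integrable_kernel_mul_prod [SFinite ν] (hk : Measurable k) (hki : Integrable k ν)
    (hf : Measurable f) (hfi : Integrable f (QTvol N T)) :
    Integrable (fun q : (Euc N × ℝ) × Euc N => k q.2 * f (spaceShift q.2 q.1))
      ((QTvol N T).prod ν) := by
  have hm : Measurable fun q : (Euc N × ℝ) × Euc N => k q.2 * f (spaceShift q.2 q.1) :=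
    (hk.comp measurable_snd).mul (hf.comp measurable_spaceShift_uncurry)
  rw [integrable_prod_iff' hm.aestronglyMeasurable]
  refine ⟨Eventually.of_forall fun z => (integrable_comp_spaceShift z hfi).const_mul (k z), ?_⟩
  have : ∀ z, ∫ p, ‖k z * f (spaceShift z p)‖ ∂(QTvol N T) =
      |k z| * ∫ p, |f p| ∂(QTvol N T) := by
    intro z
    simp only [norm_mul, Real.norm_eq_abs]
    rw [integral_const_mul, integral_comp_spaceShift z (fun p => |f p|)]
  simp only [this]
  exact hki.abs.mul_const _

theorem integrable_kcorr [SFinite ν] (hk : Measurable k) (hki : Integrable k ν)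
    (hf : Measurable f) (hfi : Integrable f (QTvol N T)) :
    Integrable (kcorr ν k f) (QTvol N T) :=
  (integrable_kernel_mul_prod hk hki hf hfi).integral_prod_left

theorem integral_abs_kcorr_le [SFinite ν] (hk : Measurable k) (hki : Integrable k ν)
    (hf : Measurable f) (hfi : Integrable f (QTvol N T)) :
    ∫ p, |kcorr ν k f p| ∂(QTvol N T) ≤ (∫ z, |k z| ∂ν) * ∫ p, |f p| ∂(QTvol N T) := by
  have h1 := integrable_kernel_mul_prod hk hki hf hfi
  calc ∫ p, |kcorr ν k f p| ∂(QTvol N T)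
      ≤ ∫ p, ∫ z, |k z * f (spaceShift z p)| ∂ν ∂(QTvol N T) :=
        integral_mono (integrable_kcorr hk hki hf hfi).abs h1.abs.integral_prod_left
          fun p => abs_integral_le_integral_abs
    _ = ∫ z, ∫ p, |k z * f (spaceShift z p)| ∂(QTvol N T) ∂ν := integral_integral_swap h1.abs
    _ = (∫ z, |k z| ∂ν) * ∫ p, |f p| ∂(QTvol N T) := by
        rw [← integral_mul_const]
        congr 1
        funext z
        simp only [abs_mul]
        rw [integral_const_mul, integral_comp_spaceShift z (fun p => |f p|)]

theorem integral_kcorr [SFinite ν] (hk : Measurable k) (hki : Integrable k ν)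
    (hf : Measurable f) (hfi : Integrable f (QTvol N T)) :
    ∫ p, kcorr ν k f p ∂(QTvol N T) = (∫ z, k z ∂ν) * ∫ p, f p ∂(QTvol N T) := by
  have h1 := integrable_kernel_mul_prod hk hki hf hfi
  unfold kcorr
  rw [integral_integral_swap h1, ← integral_mul_const]
  congr 1
  funext z
  rw [integral_const_mul, integral_comp_spaceShift z f]

theorem measurable_corr [SFinite ν] (hf : Measurable f) : Measurable (corr ν f) := by
  rw [corr_eq_kcorr]; exact measurable_kcorr measurable_const hf

theorem abs_corr_le [IsFiniteMeasure ν] (hf : Measurable f) (hC : ∀ p, |f p| ≤ C)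
    (p : Euc N × ℝ) : |corr ν f p| ≤ ν.real univ * C := by
  rw [corr_eq_kcorr]
  simpa using abs_kcorr_le (integrable_const (1 : ℝ)) hf hC p

theorem integrable_comp_spaceShift_left [IsFiniteMeasure ν] (hf : Measurable f)
    (hC : ∀ p, |f p| ≤ C) (p : Euc N × ℝ) : Integrable (fun z => f (spaceShift z p)) ν := by
  simpa using integrable_kernel_mul (integrable_const (1 : ℝ)) hf hC p

theorem integrable_comp_spaceShift_prod [IsFiniteMeasure ν]
    (hf : Measurable f) (hfi : Integrable f (QTvol N T)) :
    Integrable (fun q : (Euc N × ℝ) × Euc N => f (spaceShift q.2 q.1)) ((QTvol N T).prod ν) := by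
  simpa using integrable_kernel_mul_prod (ν := ν) measurable_const (integrable_const (1 : ℝ)) hf hfi

theorem integrable_corr [IsFiniteMeasure ν] (hf : Measurable f)
    (hfi : Integrable f (QTvol N T)) : Integrable (corr ν f) (QTvol N T) := by
  rw [corr_eq_kcorr]
  exact integrable_kcorr measurable_const (integrable_const (1 : ℝ)) hf hfi

theorem integral_abs_corr_le [IsFiniteMeasure ν] (hf : Measurable f)
    (hfi : Integrable f (QTvol N T)) :
    ∫ p, |corr ν f p| ∂(QTvol N T) ≤ ν.real univ * ∫ p, |f p| ∂(QTvol N T) := by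
  rw [corr_eq_kcorr]
  simpa using integral_abs_kcorr_le (ν := ν) measurable_const (integrable_const (1 : ℝ)) hf hfi

/-- Expansion of a pairing with a correlation as an average over translations. -/
theorem integral_mul_corr [IsFiniteMeasure ν] (hF : Measurable F) (hC : ∀ p, |F p| ≤ C)
    (hf : Measurable f) (hfi : Integrable f (QTvol N T)) :
    Integrable (fun q : (Euc N × ℝ) × Euc N => F q.1 * f (spaceShift q.2 q.1))
      ((QTvol N T).prod ν) ∧
    ∫ p, F p * corr ν f p ∂(QTvol N T) =
      ∫ z, ∫ p, F p * f (spaceShift z p) ∂(QTvol N T) ∂ν := by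
  have h1 : Integrable (fun q : (Euc N × ℝ) × Euc N => F q.1 * f (spaceShift q.2 q.1))
      ((QTvol N T).prod ν) :=
    (integrable_comp_spaceShift_prod hf hfi).bdd_mul (c := C)
      (hF.comp measurable_fst).aestronglyMeasurable (Eventually.of_forall fun _ => hC _)
  refine ⟨h1, ?_⟩
  rw [← integral_integral_swap h1]
  simp only [corr, integral_const_mul]

theorem integral_corr_mul [IsFiniteMeasure ν] (hF : Measurable F) (hC : ∀ p, |F p| ≤ C)
    (hfi : Integrable f (QTvol N T)) :
    Integrable (fun q : (Euc N × ℝ) × Euc N => F (spaceShift q.2 q.1) * f q.1)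
      ((QTvol N T).prod ν) ∧
    ∫ p, corr ν F p * f p ∂(QTvol N T) =
      ∫ z, ∫ p, F (spaceShift z p) * f p ∂(QTvol N T) ∂ν := by
  have h1 : Integrable (fun q : (Euc N × ℝ) × Euc N => F (spaceShift q.2 q.1) * f q.1)
      ((QTvol N T).prod ν) :=
    (hfi.comp_fst ν).bdd_mul (c := C)
      (hF.comp measurable_spaceShift_uncurry).aestronglyMeasurable
      (Eventually.of_forall fun _ => hC _)
  refine ⟨h1, ?_⟩
  rw [← integral_integral_swap h1]
  simp only [corr, integral_mul_const]

theorem integral_comp_neg_of_symm (hν : ν.map (fun z => -z) = ν) (h : Euc N → ℝ) :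
    ∫ z, h (-z) ∂ν = ∫ z, h z ∂ν := by
  conv_rhs => rw [← hν]
  exact ((MeasurableEquiv.neg (Euc N)).measurableEmbedding.integral_map h).symm

theorem integral_corr_mul_comm [IsFiniteMeasure ν] (hν : ν.map (fun z => -z) = ν)
    (hF : Measurable F) (hC : ∀ p, |F p| ≤ C)
    (hf : Measurable f) (hfi : Integrable f (QTvol N T)) :
    ∫ p, corr ν F p * f p ∂(QTvol N T) = ∫ p, F p * corr ν f p ∂(QTvol N T) := by
  rw [(integral_corr_mul hF hC hfi).2, (integral_mul_corr hF hC hf hfi).2,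
    ← integral_comp_neg_of_symm hν]
  congr 1
  funext z
  rw [← integral_comp_spaceShift z]
  simp [spaceShift_spaceShift]
  simp [spaceShift]

end Correlation

section Resolvent

variable {N : ℕ} {T : ℝ}

/-- Terms of the Neumann series of the resolvent of a compound Poisson generator. -/
noncomputable def resolventTerm (κ : Measure (Euc N)) (c : ENNReal) : ℕ → Measure (Euc N)
  | 0 => c⁻¹ • Measure.dirac 0
  | n + 1 => c⁻¹ • (κ.conv (resolventTerm κ c n))

theorem map_neg_conv {κ ξ : Measure (Euc N)} [SFinite κ] [SFinite ξ]
    (hκ : κ.map (fun z => -z) = κ) (hξ : ξ.map (fun z => -z) = ξ) :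
    (κ.conv ξ).map (fun z => -z) = κ.conv ξ := by
  have h := Measure.map_conv_addMonoidHom (μ := κ) (ν := ξ)
    (negAddMonoidHom : Euc N →+ Euc N) measurable_neg
  have e : (⇑(negAddMonoidHom : Euc N →+ Euc N)) = fun z => -z := rfl
  rw [e, hκ, hξ] at h
  exact h

theorem conv_univ (κ ξ : Measure (Euc N)) [SFinite κ] [SFinite ξ] :
    (κ.conv ξ) univ = κ univ * ξ univ := by
  rw [Measure.conv, Measure.map_apply (by fun_prop) MeasurableSet.univ, preimage_univ,
    ← univ_prod_univ, Measure.prod_prod]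

theorem exists_resolvent_measure (κ : Measure (Euc N)) [IsFiniteMeasure κ]
    (hκ : κ.map (fun z => -z) = κ) {ε : ℝ} (hε : 0 < ε) :
    ∃ ν : Measure (Euc N), IsFiniteMeasure ν ∧ ν.map (fun z => -z) = ν ∧
      ε * ν.real univ = 1 ∧
      ENNReal.ofReal (ε + κ.real univ) • ν = Measure.dirac 0 + κ.conv ν := by
  set c : ENNReal := ENNReal.ofReal (ε + κ.real univ) with hc
  have hpos : 0 < ε + κ.real univ := by positivity
  have hc0 : c ≠ 0 := by simp [hc, hpos]
  have hct : c ≠ ⊤ := ENNReal.ofReal_ne_top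
  have hcc : c⁻¹ * c = 1 := ENNReal.inv_mul_cancel hc0 hct
  have hcc' : c * c⁻¹ = 1 := ENNReal.mul_inv_cancel hc0 hct
  have hct' : c⁻¹ ≠ ⊤ := ENNReal.inv_ne_top.2 hc0
  set R := resolventTerm κ c with hR
  have hfin : ∀ n, IsFiniteMeasure (R n) := by
    intro n
    induction n with
    | zero => exact Measure.smul_finite _ hct'
    | succ n ih => exact Measure.smul_finite _ hct'
  have hsymm : ∀ n, (R n).map (fun z => -z) = R n := by
    intro n
    induction n with
    | zero =>
      simp [hR, resolventTerm, Measure.map_smul, measurable_neg]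
    | succ n ih =>
      have := map_neg_conv hκ ih
      change (c⁻¹ • (κ.conv (R n))).map (fun z => -z) = c⁻¹ • (κ.conv (R n))
      rw [Measure.map_smul, this]
  have hmass : ∀ n, R n univ = c⁻¹ * (c⁻¹ * κ univ) ^ n := by
    intro n
    induction n with
    | zero => simp [hR, resolventTerm]
    | succ n ih =>
      change (c⁻¹ • (κ.conv (R n))) univ = _
      rw [Measure.smul_apply, conv_univ, ih, smul_eq_mul, pow_succ]
      ring
  set ν := Measure.sum R with hν
  have hlt : c⁻¹ * κ univ < 1 := by
    rw [← hcc]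
    refine ENNReal.mul_lt_mul_right (ENNReal.inv_ne_zero.2 hct) hct' ?_
    rw [← ENNReal.ofReal_toReal (measure_ne_top κ univ), hc]
    exact (ENNReal.ofReal_lt_ofReal_iff hpos).2 (by simpa [Measure.real] using hε)
  have hνfin : IsFiniteMeasure ν := by
    constructor
    rw [hν, Measure.sum_apply _ MeasurableSet.univ]
    simp only [hmass]
    rw [ENNReal.tsum_mul_left, ENNReal.tsum_geometric]
    refine ENNReal.mul_lt_top hct'.lt_top ?_
    rw [lt_top_iff_ne_top, ENNReal.inv_ne_top]
    exact (tsub_pos_of_lt hlt).ne'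
  have heq : c • ν = Measure.dirac 0 + κ.conv ν := by
    have h1 : κ.conv ν = Measure.sum fun n => κ.conv (R n) := by
      rw [Measure.conv, hν, Measure.prod_sum_right, Measure.map_sum (by fun_prop)]
      rfl
    have h2 : ∀ n, κ.conv (R n) = c • R (n + 1) := by
      intro n
      change _ = c • (c⁻¹ • (κ.conv (R n)))
      rw [smul_smul, hcc', one_smul]
    have h3 : Measure.dirac 0 = c • R 0 := by
      change _ = c • (c⁻¹ • Measure.dirac 0)
      rw [smul_smul, hcc', one_smul]
    rw [h1, h3]
    ext s hs
    simp only [h2, Measure.smul_apply, Measure.add_apply, Measure.sum_apply _ hs, hν, smul_eq_mul]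
    rw [ENNReal.tsum_mul_left, ← mul_add, tsum_eq_zero_add' ENNReal.summable]
  refine ⟨ν, hνfin, ?_, ?_, heq⟩
  · rw [hν, Measure.map_sum (by fun_prop)]
    simp only [hsymm]
  · have h := congrArg (fun m : Measure (Euc N) => (m univ).toReal) heq
    simp only [Measure.smul_apply, Measure.add_apply, conv_univ, smul_eq_mul,
      ENNReal.toReal_mul, measure_univ] at h
    rw [ENNReal.toReal_add (by simp) (ENNReal.mul_ne_top (measure_ne_top _ _)
      (measure_ne_top _ _)), ENNReal.toReal_mul, hc, ENNReal.toReal_ofReal hpos.le] at h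
    simp only [ENNReal.toReal_one] at h
    simp only [Measure.real] at h ⊢
    linarith

variable {κ ν : Measure (Euc N)} {f : Euc N × ℝ → ℝ} {C ε : ℝ}

theorem resolvent_equation [IsFiniteMeasure κ] [IsFiniteMeasure ν] (hε : 0 < ε)
    (hν : ENNReal.ofReal (ε + κ.real univ) • ν = Measure.dirac 0 + κ.conv ν)
    (hf : Measurable f) (hC : ∀ p, |f p| ≤ C) (p : Euc N × ℝ) :
    (ε + κ.real univ) * corr ν f p = f p + corr κ (corr ν f) p := by
  have hpos : 0 < ε + κ.real univ := by positivity
  have h := congrArg (fun m : Measure (Euc N) => ∫ z, f (spaceShift z p) ∂m) hν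
  simp only [integral_smul_measure, ENNReal.toReal_ofReal hpos.le, smul_eq_mul] at h
  rw [integral_add_measure (integrable_comp_spaceShift_left hf hC p)
    (integrable_comp_spaceShift_left hf hC p), integral_dirac,
    integral_conv (integrable_comp_spaceShift_left hf hC p)] at h
  unfold corr
  rw [h]
  simp [spaceShift_spaceShift]
  simp [spaceShift]

end Resolvent

section Energy

variable {N : ℕ} {T : ℝ} {κ ν : Measure (Euc N)} {f g : Euc N × ℝ → ℝ} {C ε : ℝ}

theorem integrable_mul_of_bounded (hf : Measurable f) (hC : ∀ p, |f p| ≤ C)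
    (hg : Integrable g (QTvol N T)) : Integrable (fun p => f p * g p) (QTvol N T) :=
  hg.bdd_mul (c := C) hf.aestronglyMeasurable (Eventually.of_forall hC)

theorem integrable_sq_of_bounded (hf : Measurable f) (hC : ∀ p, |f p| ≤ C)
    (hfi : Integrable f (QTvol N T)) : Integrable (fun p => f p ^ 2) (QTvol N T) := by
  simpa only [sq] using integrable_mul_of_bounded hf hC hfi

/-- Squared `L²` distance between `f` and its translate by `z`. -/
noncomputable def shiftDefect (T : ℝ) (f : Euc N × ℝ → ℝ) (z : Euc N) : ℝ :=
  ∫ p, (f (spaceShift z p) - f p) ^ 2 ∂(QTvol N T)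

theorem integrable_shiftDefect_integrand (hf : Measurable f) (hC : ∀ p, |f p| ≤ C)
    (hfi : Integrable f (QTvol N T)) (z : Euc N) :
    Integrable (fun p => (f (spaceShift z p) - f p) ^ 2) (QTvol N T) := by
  refine integrable_sq_of_bounded (C := C + C) ((hf.comp (measurable_spaceShift z)).sub hf)
    (fun p => ?_) ((integrable_comp_spaceShift z hfi).sub hfi)
  exact (abs_sub _ _).trans (add_le_add (hC _) (hC _))

theorem shiftDefect_nonneg (z : Euc N) : 0 ≤ shiftDefect T f z :=
  integral_nonneg fun _ => sq_nonneg _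

theorem shiftDefect_eq (hf : Measurable f) (hC : ∀ p, |f p| ≤ C)
    (hfi : Integrable f (QTvol N T)) (z : Euc N) :
    shiftDefect T f z =
      2 * ∫ p, f p ^ 2 ∂(QTvol N T) - 2 * ∫ p, f p * f (spaceShift z p) ∂(QTvol N T) := by
  have h2 := integrable_sq_of_bounded hf hC hfi
  have h2' := integrable_comp_spaceShift z h2
  have hm := integrable_mul_of_bounded hf hC (integrable_comp_spaceShift z hfi)
  have e : ∀ p, (f (spaceShift z p) - f p) ^ 2 =
      (f (spaceShift z p) ^ 2 + f p ^ 2) - 2 * (f p * f (spaceShift z p)) := fun p => by ring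
  unfold shiftDefect
  simp only [e]
  have h22 : Integrable (fun p => f (spaceShift z p) ^ 2 + f p ^ 2) (QTvol N T) := h2'.add h2
  rw [integral_sub h22 (hm.const_mul 2), integral_add h2' h2, integral_const_mul,
    integral_comp_spaceShift z (fun p => f p ^ 2)]
  ring

theorem integral_shiftDefect [IsFiniteMeasure κ] (hf : Measurable f) (hC : ∀ p, |f p| ≤ C)
    (hfi : Integrable f (QTvol N T)) :
    Integrable (shiftDefect T f) κ ∧
    ∫ z, shiftDefect T f z ∂κ =
      2 * (κ.real univ * ∫ p, f p ^ 2 ∂(QTvol N T) -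
        ∫ p, f p * corr κ f p ∂(QTvol N T)) := by
  obtain ⟨h1, h2⟩ := integral_mul_corr (ν := κ) hf hC hf hfi
  have e : shiftDefect T f = fun z => 2 * ∫ p, f p ^ 2 ∂(QTvol N T) -
      2 * ∫ p, f p * f (spaceShift z p) ∂(QTvol N T) := funext fun z => shiftDefect_eq hf hC hfi z
  have h3 : Integrable (fun z => 2 * ∫ p, f p * f (spaceShift z p) ∂(QTvol N T)) κ :=
    h1.integral_prod_right.const_mul 2
  rw [e]
  refine ⟨(integrable_const _).sub h3, ?_⟩
  rw [integral_sub (integrable_const _) h3, integral_const, integral_const_mul, h2, smul_eq_mul]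
  ring

theorem shiftDefect_two_smul_le (hf : Measurable f) (hC : ∀ p, |f p| ≤ C)
    (hfi : Integrable f (QTvol N T)) (z : Euc N) :
    shiftDefect T f ((2 : ℝ) • z) ≤ 4 * shiftDefect T f z := by
  have h := integrable_shiftDefect_integrand hf hC hfi z
  have h' := integrable_comp_spaceShift z h
  calc shiftDefect T f ((2 : ℝ) • z)
      ≤ ∫ p, (2 * (f (spaceShift z (spaceShift z p)) - f (spaceShift z p)) ^ 2 +
          2 * (f (spaceShift z p) - f p) ^ 2) ∂(QTvol N T) := by
        refine integral_mono (integrable_shiftDefect_integrand hf hC hfi _)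
          ((h'.const_mul 2).add (h.const_mul 2)) fun p => ?_
        simp only [spaceShift_spaceShift, two_smul]
        nlinarith [sq_nonneg (f (spaceShift (z + z) p) - 2 * f (spaceShift z p) + f p)]
    _ = 4 * shiftDefect T f z := by
        rw [integral_add (h'.const_mul 2) (h.const_mul 2), integral_const_mul, integral_const_mul,
          integral_comp_spaceShift z (fun p => (f (spaceShift z p) - f p) ^ 2)]
        unfold shiftDefect
        ring

theorem shiftDefect_two_pow_smul_le (hf : Measurable f) (hC : ∀ p, |f p| ≤ C)
    (hfi : Integrable f (QTvol N T)) (z : Euc N) (k : ℕ) :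
    shiftDefect T f ((2 : ℝ) ^ k • z) ≤ 4 ^ k * shiftDefect T f z := by
  induction k with
  | zero => simp
  | succ k ih =>
    rw [pow_succ', pow_succ', mul_smul]
    linarith [shiftDefect_two_smul_le (T := T) hf hC hfi ((2 : ℝ) ^ k • z)]

/-- A square integrable function which is almost invariant under a translation has little mass in
a ball having many disjoint translates. -/
theorem setIntegral_sq_le_of_shiftDefect (hf : Measurable f) (hC : ∀ p, |f p| ≤ C)
    (hfi : Integrable f (QTvol N T)) {R : ℝ} {z : Euc N} {n : ℕ}
    (hz : 2 * R < 2 ^ n * ‖z‖) (K : ℕ) :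
    K * ∫ p in {p : Euc N × ℝ | ‖p.1‖ ≤ R}, f p ^ 2 ∂(QTvol N T) ≤
      2 * ∫ p, f p ^ 2 ∂(QTvol N T) + 2 * K * 4 ^ (n + K) * shiftDefect T f z := by
  set B : Set (Euc N × ℝ) := {p | ‖p.1‖ ≤ R} with hB
  have hBm : MeasurableSet B := measurableSet_le (by fun_prop) (by fun_prop)
  have h2 := integrable_sq_of_bounded hf hC hfi
  let h : ℕ → Euc N := fun k => (2 : ℝ) ^ (n + k) • z
  let S : ℕ → Set (Euc N × ℝ) := fun k => spaceShift (-(h k)) ⁻¹' B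
  have hSm : ∀ k, MeasurableSet (S k) := fun k => measurable_spaceShift _ hBm
  have hsep : ∀ j k, j < k → Disjoint (S j) (S k) := by
    intro j k hjk
    rw [Set.disjoint_left]
    intro p hpj hpk
    simp only [S, hB, spaceShift, mem_preimage, mem_ofPred_eq] at hpj hpk
    have e : ‖h k - h j‖ ≤ R + R := by
      have : h k - h j = (p.1 + -h j) - (p.1 + -h k) := by abel
      rw [this]
      exact (norm_sub_le _ _).trans (add_le_add hpj hpk)
    have e2 : h k - h j = ((2 : ℝ) ^ (n + k) - 2 ^ (n + j)) • z := by simp [h, sub_smul]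
    rw [e2, norm_smul, Real.norm_eq_abs] at e
    have e3 : (2 : ℝ) ^ n ≤ 2 ^ (n + k) - 2 ^ (n + j) := by
      have a1 : (2 : ℝ) ^ (n + j + 1) ≤ 2 ^ (n + k) :=
        pow_le_pow_right₀ (by norm_num) (by omega)
      have a2 : (2 : ℝ) ^ n ≤ 2 ^ (n + j) := pow_le_pow_right₀ (by norm_num) (by omega)
      rw [pow_succ] at a1
      linarith
    have e4 : (2 : ℝ) ^ n * ‖z‖ ≤ |(2 : ℝ) ^ (n + k) - 2 ^ (n + j)| * ‖z‖ :=
      mul_le_mul_of_nonneg_right (e3.trans (le_abs_self _)) (norm_nonneg _)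
    linarith
  have hterm : ∀ k, k < K → ∫ p in B, f p ^ 2 ∂(QTvol N T) ≤
      2 * ∫ p in S k, f p ^ 2 ∂(QTvol N T) + 2 * (4 ^ (n + K) * shiftDefect T f z) := by
    intro k hk
    have hd := integrable_shiftDefect_integrand hf hC hfi (h k)
    have h2k := integrable_comp_spaceShift (h k) h2
    have s1 : ∫ p in B, f p ^ 2 ∂(QTvol N T) ≤
        ∫ p in B, (2 * f (spaceShift (h k) p) ^ 2 +
          2 * (f (spaceShift (h k) p) - f p) ^ 2) ∂(QTvol N T) := by
      refine integral_mono h2.integrableOn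
        ((h2k.const_mul 2).add (hd.const_mul 2)).integrableOn fun p => ?_
      dsimp only
      nlinarith [sq_nonneg (2 * f (spaceShift (h k) p) - f p)]
    rw [integral_add (h2k.const_mul 2).integrableOn (hd.const_mul 2).integrableOn,
      integral_const_mul, integral_const_mul] at s1
    have s2 : ∫ p in B, f (spaceShift (h k) p) ^ 2 ∂(QTvol N T) =
        ∫ p in S k, f p ^ 2 ∂(QTvol N T) := by
      rw [← integral_indicator hBm, ← integral_indicator (hSm k),
        ← integral_comp_spaceShift (h k) ((S k).indicator fun p => f p ^ 2)]
      congr 1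
      funext p
      have : spaceShift (h k) p ∈ S k ↔ p ∈ B := by
        simp [S, hB, spaceShift]
      by_cases hp : p ∈ B
      · rw [indicator_of_mem hp, indicator_of_mem (this.2 hp)]
      · rw [indicator_of_notMem hp, indicator_of_notMem (fun h => hp (this.1 h))]
    have s3 : ∫ p in B, (f (spaceShift (h k) p) - f p) ^ 2 ∂(QTvol N T) ≤
        shiftDefect T f (h k) :=
      setIntegral_le_integral hd (Eventually.of_forall fun _ => sq_nonneg _)
    have s4 : shiftDefect T f (h k) ≤ 4 ^ (n + K) * shiftDefect T f z :=
      (shiftDefect_two_pow_smul_le hf hC hfi z (n + k)).trans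
        (mul_le_mul_of_nonneg_right (pow_le_pow_right₀ (by norm_num) (by omega))
          (shiftDefect_nonneg z))
    rw [s2] at s1
    linarith
  have hsum : ∑ k ∈ Finset.range K, ∫ p in S k, f p ^ 2 ∂(QTvol N T) ≤
      ∫ p, f p ^ 2 ∂(QTvol N T) := by
    rw [← integral_biUnion_finset _ (fun k _ => hSm k) ?_ (fun k _ => h2.integrableOn)]
    · exact setIntegral_le_integral h2 (Eventually.of_forall fun _ => sq_nonneg _)
    · intro j _ k _ hjk
      rcases lt_or_gt_of_ne hjk with h' | h'
      · exact hsep j k h'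
      · exact (hsep k j h').symm
  have htot := Finset.sum_le_sum fun k hk => hterm k (Finset.mem_range.1 hk)
  rw [Finset.sum_const, Finset.card_range, nsmul_eq_mul, Finset.sum_add_distrib,
    ← Finset.mul_sum, Finset.sum_const, Finset.card_range, nsmul_eq_mul] at htot
  linarith

theorem resolvent_energy [IsFiniteMeasure κ] [IsFiniteMeasure ν] (hε : 0 < ε)
    (hν : ENNReal.ofReal (ε + κ.real univ) • ν = Measure.dirac 0 + κ.conv ν)
    (hf : Measurable f) (hC : ∀ p, |f p| ≤ C) (hfi : Integrable f (QTvol N T)) :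
    ∫ p, f p * corr ν f p ∂(QTvol N T) =
      ε * ∫ p, corr ν f p ^ 2 ∂(QTvol N T) +
        (1 / 2) * ∫ z, shiftDefect T (corr ν f) z ∂κ := by
  have hZm := measurable_corr (ν := ν) hf
  have hZC := abs_corr_le (ν := ν) hf hC
  have hZi := integrable_corr (ν := ν) hf hfi
  rw [(integral_shiftDefect hZm hZC hZi).2]
  have i1 := integrable_sq_of_bounded hZm hZC hZi
  have i2 := integrable_mul_of_bounded hZm hZC (integrable_corr (ν := κ) hZm hZi)
  have e : ∀ p, f p * corr ν f p =
      (ε + κ.real univ) * corr ν f p ^ 2 - corr ν f p * corr κ (corr ν f) p := by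
    intro p
    have := resolvent_equation hε hν hf hC p
    linear_combination (- corr ν f p) * this
  simp only [e]
  rw [integral_sub (i1.const_mul _) i2, integral_const_mul]
  ring

theorem resolvent_nonneg [IsFiniteMeasure κ] [IsFiniteMeasure ν] (hε : 0 < ε)
    (hν : ENNReal.ofReal (ε + κ.real univ) • ν = Measure.dirac 0 + κ.conv ν)
    (hf : Measurable f) (hC : ∀ p, |f p| ≤ C) (hfi : Integrable f (QTvol N T)) :
    0 ≤ ∫ p, f p * corr ν f p ∂(QTvol N T) := by
  rw [resolvent_energy hε hν hf hC hfi]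
  have h1 : 0 ≤ ∫ p, corr ν f p ^ 2 ∂(QTvol N T) := integral_nonneg fun _ => sq_nonneg _
  have h2 : 0 ≤ ∫ z, shiftDefect T (corr ν f) z ∂κ := integral_nonneg fun z => shiftDefect_nonneg z
  positivity

theorem resolvent_bounds [IsFiniteMeasure κ] [IsFiniteMeasure ν] (hε : 0 < ε)
    (hν : ENNReal.ofReal (ε + κ.real univ) • ν = Measure.dirac 0 + κ.conv ν)
    (hf : Measurable f) (hC : ∀ p, |f p| ≤ C) (hfi : Integrable f (QTvol N T)) :
    ε ^ 2 * ∫ p, corr ν f p ^ 2 ∂(QTvol N T) ≤ ∫ p, f p ^ 2 ∂(QTvol N T) ∧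
    ε * ∫ z, shiftDefect T (corr ν f) z ∂κ ≤ ∫ p, f p ^ 2 ∂(QTvol N T) := by
  have hZm := measurable_corr (ν := ν) hf
  have hZC := abs_corr_le (ν := ν) hf hC
  have hZi := integrable_corr (ν := ν) hf hfi
  have i1 := integrable_sq_of_bounded hZm hZC hZi
  have i2 := integrable_sq_of_bounded hf hC hfi
  have en := resolvent_energy hε hν hf hC hfi
  have h1 : 0 ≤ ∫ p, corr ν f p ^ 2 ∂(QTvol N T) := integral_nonneg fun _ => sq_nonneg _
  have h2 : 0 ≤ ∫ z, shiftDefect T (corr ν f) z ∂κ := integral_nonneg fun z => shiftDefect_nonneg z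
  have h3 : ε * ∫ p, f p * corr ν f p ∂(QTvol N T) ≤
      (1 / 2) * ∫ p, f p ^ 2 ∂(QTvol N T) + (ε ^ 2 / 2) * ∫ p, corr ν f p ^ 2 ∂(QTvol N T) := by
    rw [← integral_const_mul, ← integral_const_mul, ← integral_const_mul,
      ← integral_add (i2.const_mul _) (i1.const_mul _)]
    refine integral_mono ((integrable_mul_of_bounded hf hC hZi).const_mul _)
      ((i2.const_mul _).add (i1.const_mul _)) fun p => ?_
    dsimp only
    nlinarith [sq_nonneg (f p - ε * corr ν f p)]
  rw [en] at h3
  constructor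
  · nlinarith [mul_nonneg hε.le h2]
  · nlinarith [mul_nonneg (sq_nonneg ε) h1]

/-- The normalized resolvents of nondegenerate compound Poisson generators tend to zero locally
in `L²`, uniformly with respect to the generator. -/
theorem exists_setIntegral_sq_resolvent_le {c₀ a₀ : ℝ} (hc₀ : 0 < c₀) (ha₀ : 0 < a₀) (R : ℝ)
    {η : ℝ} (hη : 0 < η) :
    ∃ ε₀ > 0, ∀ ε : ℝ, 0 < ε → ε < ε₀ → ∀ κ ν : Measure (Euc N), IsFiniteMeasure κ →
      IsFiniteMeasure ν → a₀ ≤ κ.real {z | c₀ < ‖z‖} →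
      ENNReal.ofReal (ε + κ.real univ) • ν = Measure.dirac 0 + κ.conv ν →
      ∀ (f : Euc N × ℝ → ℝ) (C : ℝ), Measurable f → (∀ p, |f p| ≤ C) →
        Integrable f (QTvol N T) →
        ∫ p in {p : Euc N × ℝ | ‖p.1‖ ≤ R}, (ε * corr ν f p) ^ 2 ∂(QTvol N T) ≤
          η * ∫ p, f p ^ 2 ∂(QTvol N T) := by
  obtain ⟨n, hn⟩ := pow_unbounded_of_one_lt (2 * R / c₀) (by norm_num : (1 : ℝ) < 2)
  obtain ⟨K, hK⟩ := exists_nat_gt (4 / η)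
  have hK0 : (0 : ℝ) < K := lt_trans (by positivity) hK
  refine ⟨a₀ * η / (4 * 4 ^ (n + K)), by positivity, ?_⟩
  intro ε hε hε₀ κ ν hκf hνf hκa hν f C hf hC hfi
  set A : Set (Euc N) := {z | c₀ < ‖z‖} with hA
  have hAm : MeasurableSet A := measurableSet_lt (by fun_prop) (by fun_prop)
  have hZm := measurable_corr (ν := ν) hf
  have hZC := abs_corr_le (ν := ν) hf hC
  have hZi := integrable_corr (ν := ν) hf hfi
  obtain ⟨b1, b2⟩ := resolvent_bounds hε hν hf hC hfi
  set IB := ∫ p in {p : Euc N × ℝ | ‖p.1‖ ≤ R}, corr ν f p ^ 2 ∂(QTvol N T) with hIB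
  set I := ∫ p, corr ν f p ^ 2 ∂(QTvol N T) with hI
  set J := ∫ p, f p ^ 2 ∂(QTvol N T) with hJ
  set D := ∫ z, shiftDefect T (corr ν f) z ∂κ with hD
  have hDi := (integral_shiftDefect (κ := κ) hZm hZC hZi).1
  have hpt : ∀ z ∈ A, K * IB ≤ 2 * I + 2 * K * 4 ^ (n + K) * shiftDefect T (corr ν f) z := by
    intro z hz
    refine setIntegral_sq_le_of_shiftDefect hZm hZC hZi ?_ K
    rw [div_lt_iff₀ hc₀] at hn
    exact hn.trans_le (mul_le_mul_of_nonneg_left (le_of_lt hz) (by positivity))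
  have hint : κ.real A * (K * IB) ≤ κ.real A * (2 * I) + 2 * K * 4 ^ (n + K) * D := by
    have h1 : ∫ z in A, (K * IB) ∂κ ≤
        ∫ z in A, (2 * I + 2 * K * 4 ^ (n + K) * shiftDefect T (corr ν f) z) ∂κ :=
      setIntegral_mono_on (integrable_const _).integrableOn
        ((integrable_const _).add (hDi.const_mul _)).integrableOn hAm hpt
    rw [integral_add (integrable_const _) (hDi.const_mul _).integrableOn, setIntegral_const,
      setIntegral_const, integral_const_mul, smul_eq_mul, smul_eq_mul] at h1
    have h2 : ∫ z in A, shiftDefect T (corr ν f) z ∂κ ≤ D :=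
      setIntegral_le_integral hDi (Eventually.of_forall fun z => shiftDefect_nonneg z)
    have h3 := mul_le_mul_of_nonneg_left h2 (by positivity : (0 : ℝ) ≤ 2 * K * 4 ^ (n + K))
    linarith
  have hJ0 : 0 ≤ J := integral_nonneg fun _ => sq_nonneg _
  have hgoal : ∫ p in {p : Euc N × ℝ | ‖p.1‖ ≤ R}, (ε * corr ν f p) ^ 2 ∂(QTvol N T) =
      ε ^ 2 * IB := by
    simp only [mul_pow]
    rw [integral_const_mul]
  rw [hgoal]
  have hk : 0 < κ.real A := ha₀.trans_le hκa
  have m1 : κ.real A * K * (ε ^ 2 * IB) ≤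
      κ.real A * 2 * J + 2 * K * 4 ^ (n + K) * (ε * J) := by
    have a1 := mul_le_mul_of_nonneg_left hint (sq_nonneg ε)
    have a2 := mul_le_mul_of_nonneg_left b1 (by positivity : 0 ≤ κ.real A * 2)
    have a3 := mul_le_mul_of_nonneg_left b2 (by positivity : 0 ≤ 2 * K * 4 ^ (n + K) * ε)
    linarith
  have m2 : 2 * J ≤ (η / 2) * K * J := by
    refine mul_le_mul_of_nonneg_right ?_ hJ0
    rw [div_lt_iff₀ hη] at hK
    linarith
  have m3 : 2 * 4 ^ (n + K) * ε ≤ κ.real A * (η / 2) := by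
    rw [lt_div_iff₀ (by positivity)] at hε₀
    nlinarith
  have m4 : κ.real A * K * (ε ^ 2 * IB) ≤ κ.real A * K * (η * J) := by
    have a2 := mul_le_mul_of_nonneg_left m2 hk.le
    have a3 := mul_le_mul_of_nonneg_right m3 (by positivity : 0 ≤ K * J)
    linarith
  exact le_of_mul_le_mul_left m4 (by positivity)

end Energy

section Levy

variable {N : ℕ} {μ : Measure (Euc N)} {ρ : Euc N → ℝ}

theorem IsLevyMeasure.integrable_min (hμ : IsLevyMeasure μ) :
    Integrable (fun z => min (‖z‖ ^ 2) 1) μ := by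
  have hm : Measurable fun z : Euc N => min (‖z‖ ^ 2) 1 := by fun_prop
  refine ⟨hm.aestronglyMeasurable, ?_⟩
  rw [hasFiniteIntegral_iff_ofReal (Eventually.of_forall fun z => by positivity)]
  exact lt_top_iff_ne_top.2 hμ.2.2

theorem IsLevyMeasure.measure_norm_gt_lt_top (hμ : IsLevyMeasure μ) {r : ℝ} (hr : 0 < r) :
    μ {z | r < ‖z‖} < ⊤ := by
  refine (measure_mono fun z (hz : r < ‖z‖) => ?_).trans_lt
    (hμ.integrable_min.measure_gt_lt_top (ε := min (r ^ 2) 1 / 2) (by positivity))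
  have h1 : min (r ^ 2) 1 / 2 < min (r ^ 2) 1 := half_lt_self (by positivity)
  have h2 : min (r ^ 2) 1 ≤ min (‖z‖ ^ 2) 1 := by gcongr
  exact h1.trans_le h2

theorem measurableSet_norm_gt (r : ℝ) : MeasurableSet {z : Euc N | r < ‖z‖} :=
  measurableSet_lt measurable_const measurable_norm

theorem IsLevyMeasure.isFiniteMeasure_restrict (hμ : IsLevyMeasure μ) {r : ℝ} (hr : 0 < r) :
    IsFiniteMeasure (μ.restrict {z | r < ‖z‖}) :=
  ⟨by rw [Measure.restrict_apply_univ]; exact hμ.measure_norm_gt_lt_top hr⟩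

theorem IsLevyMeasure.map_neg_restrict (hμ : IsLevyMeasure μ) (r : ℝ) :
    (μ.restrict {z | r < ‖z‖}).map (fun z => -z) = μ.restrict {z | r < ‖z‖} := by
  conv_rhs => rw [← hμ.2.1]
  rw [Measure.restrict_map measurable_neg (measurableSet_norm_gt r)]
  simp

theorem IsLevyMeasure.sigmaFinite (hμ : IsLevyMeasure μ) : SigmaFinite μ := by
  refine ⟨⟨⟨fun n : ℕ => {0} ∪ {z | 1 / ((n : ℝ) + 1) < ‖z‖}, fun _ => trivial, fun n => ?_, ?_⟩⟩⟩
  · refine (measure_union_le _ _).trans_lt (ENNReal.add_lt_top.2 ⟨by simp [hμ.1], ?_⟩)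
    exact hμ.measure_norm_gt_lt_top (by positivity)
  · refine eq_univ_of_forall fun z => mem_iUnion.2 ?_
    by_cases hz : z = 0
    · exact ⟨0, Or.inl hz⟩
    · obtain ⟨n, hn⟩ := exists_nat_one_div_lt (norm_pos_iff.2 hz)
      exact ⟨n, Or.inr hn⟩

/-- The integrand of the nonlocal operator. -/
noncomputable def levyIntegrand (ρ : Euc N → ℝ) (x z : Euc N) : ℝ :=
  ρ (x + z) - ρ x - (if ‖z‖ ≤ 1 then fderiv ℝ ρ x z else 0)

theorem IsTestFn.integrable (hρ : IsTestFn ρ) : Integrable ρ :=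
  hρ.1.continuous.integrable_of_hasCompactSupport hρ.2

theorem IsTestFn.continuous_fderiv (hρ : IsTestFn ρ) : Continuous (fderiv ℝ ρ) :=
  hρ.1.continuous_fderiv (by simp)

theorem IsTestFn.integrable_fderiv (hρ : IsTestFn ρ) (z : Euc N) :
    Integrable fun x => fderiv ℝ ρ x z := by
  refine (hρ.continuous_fderiv.clm_apply continuous_const).integrable_of_hasCompactSupport ?_
  exact hρ.2.fderiv_apply (𝕜 := ℝ) z

theorem IsTestFn.measurable_levyIntegrand (hρ : IsTestFn ρ) :
    Measurable fun q : Euc N × Euc N => levyIntegrand ρ q.1 q.2 := by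
  have h1 := hρ.1.continuous
  have h2 := hρ.continuous_fderiv
  unfold levyIntegrand
  refine Measurable.sub ?_ (Measurable.ite ?_ ?_ measurable_const)
  · exact (by fun_prop : Continuous fun q : Euc N × Euc N => ρ (q.1 + q.2) - ρ q.1).measurable
  · exact measurableSet_le (by fun_prop) (by fun_prop)
  · exact (by fun_prop : Continuous fun q : Euc N × Euc N => fderiv ℝ ρ q.1 q.2).measurable

theorem IsTestFn.integrable_levyIntegrand_left (hρ : IsTestFn ρ) (z : Euc N) :
    Integrable fun x => levyIntegrand ρ x z := by
  unfold levyIntegrand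
  refine ((hρ.integrable.comp_add_right z).sub hρ.integrable).sub ?_
  split_ifs
  · exact hρ.integrable_fderiv z
  · exact integrable_zero _ _ _

theorem IsTestFn.exists_abs_taylor_le (hρ : IsTestFn ρ) :
    ∃ M : ℝ, 0 ≤ M ∧ ∀ x z, |ρ (x + z) - ρ x - fderiv ℝ ρ x z| ≤ M * ‖z‖ ^ 2 := by
  have hc : ContDiff ℝ 1 (fderiv ℝ ρ) := hρ.1.fderiv_right (by norm_cast)
  obtain ⟨M, hM⟩ := hc.lipschitzWith_of_hasCompactSupport (hρ.2.fderiv (𝕜 := ℝ)) one_ne_zero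
  refine ⟨M, M.2, fun x z => ?_⟩
  have h := (convex_closedBall x ‖z‖).norm_image_sub_le_of_norm_fderiv_le' (𝕜 := ℝ) (f := ρ)
    (φ := fderiv ℝ ρ x) (C := M * ‖z‖) (x := x) (y := x + z)
    (fun y _ => (hρ.1.differentiable (by simp)).differentiableAt) (fun y hy => ?_)
    (by simp) (by simp)
  · rw [add_sub_cancel_left, Real.norm_eq_abs] at h
    rw [sq, ← mul_assoc]; exact h
  · refine (hM.norm_sub_le y x).trans ?_
    gcongr
    simpa [dist_eq_norm] using hy

theorem IsTestFn.exists_integral_abs_levyIntegrand_le (hρ : IsTestFn ρ) :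
    ∃ M : ℝ, 0 ≤ M ∧ ∀ z, ∫ x, |levyIntegrand ρ x z| ≤ M * min (‖z‖ ^ 2) 1 := by
  obtain ⟨M, hM0, hM⟩ := hρ.exists_abs_taylor_le
  set B : Set (Euc N) := Metric.cthickening 1 (tsupport ρ) with hB
  have hBc : IsCompact B := hρ.2.isCompact.cthickening
  have hBf : volume B ≠ ⊤ := hBc.measure_lt_top.ne
  have hI : 0 ≤ ∫ x, |ρ x| := integral_nonneg fun _ => abs_nonneg _
  refine ⟨M * volume.real B + 2 * ∫ x, |ρ x|, by positivity, fun z => ?_⟩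
  have hi := (hρ.integrable_levyIntegrand_left z).abs
  rcases le_or_gt ‖z‖ 1 with hz | hz
  · have hmin : min (‖z‖ ^ 2) 1 = ‖z‖ ^ 2 := min_eq_left (pow_le_one₀ (norm_nonneg _) hz)
    have hpt : ∀ x, |levyIntegrand ρ x z| ≤ B.indicator (fun _ => M * ‖z‖ ^ 2) x := by
      intro x
      by_cases hx : x ∈ B
      · rw [indicator_of_mem hx, levyIntegrand, if_pos hz]
        exact hM x z
      · have h0 : x ∉ tsupport ρ := fun h => hx (Metric.self_subset_cthickening _ h)
        have h1 : x + z ∉ tsupport ρ := fun h => hx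
          (Metric.mem_cthickening_of_dist_le x (x + z) 1 _ h (by simpa [dist_eq_norm] using hz))
        have h2 : fderiv ℝ ρ x = 0 := by
          by_contra h
          exact h0 (tsupport_fderiv_subset ℝ (subset_tsupport _ h))
        rw [indicator_of_notMem hx, levyIntegrand, image_eq_zero_of_notMem_tsupport h0,
          image_eq_zero_of_notMem_tsupport h1, h2]
        simp
    have h := integral_mono hi ((integrable_indicator_iff hBc.measurableSet).2
      (integrableOn_const hBf)) hpt
    rw [integral_indicator hBc.measurableSet, setIntegral_const, smul_eq_mul] at h
    rw [hmin]
    nlinarith [mul_nonneg hI (sq_nonneg ‖z‖)]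
  · have hmin : min (‖z‖ ^ 2) 1 = 1 := min_eq_right (one_le_pow₀ hz.le)
    have h1 := hρ.integrable.abs.comp_add_right z
    have h := integral_mono hi (h1.add hρ.integrable.abs) (fun x => by
      simp only [levyIntegrand, if_neg (not_le.2 hz), sub_zero]
      exact abs_sub _ _)
    rw [integral_add' h1 hρ.integrable.abs, integral_add_right_eq_self (fun x => |ρ x|) z] at h
    rw [hmin]
    have := mul_nonneg hM0 (measureReal_nonneg (μ := (volume : Measure (Euc N))) (s := B))
    linarith

theorem IsLevyMeasure.integrable_levyIntegrand_prod [SFinite μ] (hμ : IsLevyMeasure μ)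
    (hρ : IsTestFn ρ) :
    Integrable (fun q : Euc N × Euc N => levyIntegrand ρ q.1 q.2) (volume.prod μ) := by
  have hm := hρ.measurable_levyIntegrand
  rw [integrable_prod_iff' hm.aestronglyMeasurable]
  refine ⟨Eventually.of_forall fun z => hρ.integrable_levyIntegrand_left z, ?_⟩
  obtain ⟨M, hM0, hM⟩ := hρ.exists_integral_abs_levyIntegrand_le
  refine (hμ.integrable_min.const_mul M).mono' ?_ (Eventually.of_forall fun z => ?_)
  · exact hm.norm.stronglyMeasurable.integral_prod_left'.aestronglyMeasurable
  · rw [Real.norm_of_nonneg (integral_nonneg fun _ => norm_nonneg _)]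
    exact hM z

theorem IsTestFn.measurable_Lop [SFinite μ] (hρ : IsTestFn ρ) : Measurable (Lop μ ρ) :=
  hρ.measurable_levyIntegrand.stronglyMeasurable.integral_prod_right.measurable

theorem IsLevyMeasure.integrable_Lop [SFinite μ] (hμ : IsLevyMeasure μ) (hρ : IsTestFn ρ) :
    Integrable (Lop μ ρ) :=
  (hμ.integrable_levyIntegrand_prod hρ).integral_prod_left

/-- The nonlocal operator with a finite jump measure and without compensator. -/
noncomputable def jumpOp (κ : Measure (Euc N)) (ρ : Euc N → ℝ) (x : Euc N) : ℝ :=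
  ∫ z, (ρ (x + z) - ρ x) ∂κ

theorem IsTestFn.exists_abs_le (hρ : IsTestFn ρ) : ∃ C, ∀ x, |ρ x| ≤ C :=
  hρ.2.exists_bound_of_continuous hρ.1.continuous

theorem IsTestFn.integrable_jump {κ : Measure (Euc N)} [IsFiniteMeasure κ] (hρ : IsTestFn ρ)
    (x : Euc N) : Integrable (fun z => ρ (x + z) - ρ x) κ := by
  obtain ⟨C, hC⟩ := hρ.exists_abs_le
  have hc := hρ.1.continuous
  refine Integrable.of_bound (by fun_prop) (C + C) (Eventually.of_forall fun z => ?_)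
  exact (abs_sub _ _).trans (add_le_add (hC _) (hC _))

theorem Lop_eq_jumpOp {κ : Measure (Euc N)} [IsFiniteMeasure κ]
    (hκ : κ.map (fun z => -z) = κ) (hρ : IsTestFn ρ) (x : Euc N) :
    Lop κ ρ x = jumpOp κ ρ x := by
  have hg : Integrable (fun z => if ‖z‖ ≤ 1 then fderiv ℝ ρ x z else 0) κ := by
    refine Integrable.of_bound (C := ‖fderiv ℝ ρ x‖) ?_ (Eventually.of_forall fun z => ?_)
    · exact (Measurable.ite (measurableSet_le (by fun_prop) (by fun_prop))
        (fderiv ℝ ρ x).continuous.measurable measurable_const).aestronglyMeasurable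
    · split_ifs with hz
      · exact ((fderiv ℝ ρ x).le_opNorm z).trans
          (mul_le_of_le_one_right (norm_nonneg _) hz)
      · simp
  have h0 : ∫ z, (if ‖z‖ ≤ 1 then fderiv ℝ ρ x z else 0) ∂κ = 0 := by
    have h := integral_comp_neg_of_symm hκ fun z => if ‖z‖ ≤ 1 then fderiv ℝ ρ x z else 0
    have e : (fun z : Euc N => if ‖-z‖ ≤ 1 then fderiv ℝ ρ x (-z) else 0) =
        fun z => -(if ‖z‖ ≤ 1 then fderiv ℝ ρ x z else 0) := by
      funext z
      rw [norm_neg, map_neg]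
      split_ifs <;> simp
    rw [e, integral_neg] at h
    linarith
  rw [Lop, integral_sub (hρ.integrable_jump x) hg, h0, sub_zero, jumpOp]

/-- Truncating the small jumps changes the nonlocal operator by little in `L¹`. -/
theorem IsLevyMeasure.exists_integral_abs_Lop_sub_le [SFinite μ] (hμ : IsLevyMeasure μ)
    (hρ : IsTestFn ρ) {η c : ℝ} (hη : 0 < η) (hc : 0 < c) :
    ∃ r, 0 < r ∧ r < c ∧
      ∫ x, |Lop μ ρ x - jumpOp (μ.restrict {z | r < ‖z‖}) ρ x| ≤ η := by
  obtain ⟨M, hM0, hM⟩ := hρ.exists_integral_abs_levyIntegrand_le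
  have hmin := hμ.integrable_min
  have hlim : Tendsto (fun n : ℕ => ∫ z in {z | 1 / ((n : ℝ) + 1) < ‖z‖}ᶜ, min (‖z‖ ^ 2) 1 ∂μ)
      atTop (nhds 0) := by
    have hd := tendsto_integral_of_dominated_convergence (μ := μ)
      (F := fun (n : ℕ) => indicator {z : Euc N | 1 / ((n : ℝ) + 1) < ‖z‖}ᶜ
        fun z => min (‖z‖ ^ 2) 1) (f := fun _ => 0) (fun z => min (‖z‖ ^ 2) 1)
      (fun n => (hmin.indicator (measurableSet_norm_gt _).compl).aestronglyMeasurable) hmin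
      (fun n => Eventually.of_forall fun z => ?_) (Eventually.of_forall fun z => ?_)
    · simpa only [integral_indicator (measurableSet_norm_gt _).compl, integral_zero] using hd
    · refine (norm_indicator_le_norm_self _ _).trans ?_
      rw [Real.norm_of_nonneg (by positivity)]
    · by_cases hz : z = 0
      · refine tendsto_const_nhds.congr fun n => ?_
        simp [hz, indicator]
      · obtain ⟨n, hn⟩ := exists_nat_one_div_lt (norm_pos_iff.2 hz)
        refine tendsto_const_nhds.congr' ?_
        filter_upwards [eventually_ge_atTop n] with k hk
        rw [indicator_of_notMem]
        simp only [mem_compl_iff, not_not]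
        refine lt_of_le_of_lt ?_ hn
        exact one_div_le_one_div_of_le (by positivity) (by exact_mod_cast Nat.succ_le_succ hk)
  have h1 : ∀ᶠ n : ℕ in atTop, M *
      ∫ z in {z | 1 / ((n : ℝ) + 1) < ‖z‖}ᶜ, min (‖z‖ ^ 2) 1 ∂μ ≤ η :=
    ((mul_zero M ▸ hlim.const_mul M).eventually_lt_const hη).mono fun _ h => h.le
  have h2 : ∀ᶠ n : ℕ in atTop, 1 / ((n : ℝ) + 1) < c :=
    tendsto_one_div_add_atTop_nhds_zero_nat.eventually_lt_const hc
  obtain ⟨n, hn1, hn2⟩ := (h1.and h2).exists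
  set r : ℝ := 1 / ((n : ℝ) + 1) with hr
  have hr0 : 0 < r := by positivity
  refine ⟨r, hr0, hn2, ?_⟩
  have := hμ.isFiniteMeasure_restrict hr0
  have hprod := hμ.integrable_levyIntegrand_prod hρ
  set S : Set (Euc N) := {z | r < ‖z‖} with hS
  have hSm : MeasurableSet S := measurableSet_norm_gt r
  have hprod' : Integrable (fun q : Euc N × Euc N => levyIntegrand ρ q.1 q.2)
      (volume.prod (μ.restrict Sᶜ)) := by
    refine hprod.mono_measure ?_
    exact Measure.prod_mono le_rfl Measure.restrict_le_self
  have hae : ∀ᵐ x : Euc N, Lop μ ρ x - jumpOp (μ.restrict S) ρ x =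
      ∫ z in Sᶜ, levyIntegrand ρ x z ∂μ := by
    filter_upwards [hprod.prod_right_ae] with x hx
    rw [← Lop_eq_jumpOp (hμ.map_neg_restrict r) hρ]
    have := integral_add_compl hSm hx
    simp only [Lop]
    simp only [levyIntegrand] at this ⊢
    linarith
  calc ∫ x, |Lop μ ρ x - jumpOp (μ.restrict S) ρ x|
      = ∫ x, |∫ z in Sᶜ, levyIntegrand ρ x z ∂μ| :=
        integral_congr_ae (hae.mono fun x hx => by simp only [hx])
    _ ≤ ∫ x, ∫ z in Sᶜ, |levyIntegrand ρ x z| ∂μ :=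
        integral_mono hprod'.integral_prod_left.abs hprod'.abs.integral_prod_left
          fun x => abs_integral_le_integral_abs
    _ = ∫ z in Sᶜ, (∫ x, |levyIntegrand ρ x z|) ∂μ := integral_integral_swap hprod'.abs
    _ ≤ ∫ z in Sᶜ, M * min (‖z‖ ^ 2) 1 ∂μ :=
        integral_mono hprod'.abs.integral_prod_right (hmin.const_mul M).integrableOn hM
    _ = M * ∫ z in Sᶜ, min (‖z‖ ^ 2) 1 ∂μ := integral_const_mul _ _
    _ ≤ η := hn1

variable {κ : Measure (Euc N)} {f : Euc N × ℝ → ℝ} {C : ℝ}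

theorem integrable_shift_prod [IsFiniteMeasure κ] (hρ : IsTestFn ρ) :
    Integrable (fun q : Euc N × Euc N => ρ (q.1 + q.2)) (volume.prod κ) := by
  have hc := hρ.1.continuous
  have hm : Continuous fun q : Euc N × Euc N => ρ (q.1 + q.2) := by fun_prop
  rw [integrable_prod_iff' hm.aestronglyMeasurable]
  refine ⟨Eventually.of_forall fun z => hρ.integrable.comp_add_right z, ?_⟩
  simp only [integral_add_right_eq_self (fun x => ‖ρ x‖)]
  exact integrable_const _

theorem integrable_jumpOp [IsFiniteMeasure κ] (hρ : IsTestFn ρ) :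
    Integrable (jumpOp κ ρ) := by
  exact ((integrable_shift_prod hρ).sub (hρ.integrable.comp_fst κ)).integral_prod_left

theorem kcorr_jumpOp [IsFiniteMeasure κ] (hκ : κ.map (fun z => -z) = κ) (hρ : IsTestFn ρ)
    (hf : Measurable f) (hC : ∀ p, |f p| ≤ C) (p : Euc N × ℝ) :
    kcorr volume (jumpOp κ ρ) f p =
      corr κ (kcorr volume ρ f) p - κ.real univ * kcorr volume ρ f p := by
  have h1 : Integrable (fun q : Euc N × Euc N => ρ (q.1 + q.2) * f (spaceShift q.1 p))
      (volume.prod κ) := (integrable_shift_prod hρ).mul_bdd (c := C)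
    ((hf.comp (measurable_spaceShift_left p)).comp measurable_fst).aestronglyMeasurable
    (Eventually.of_forall fun _ => hC _)
  have h2 : Integrable (fun y => ρ y * f (spaceShift y p)) :=
    integrable_kernel_mul hρ.integrable hf hC p
  have e : ∀ᵐ y : Euc N, jumpOp κ ρ y * f (spaceShift y p) =
      (∫ z, ρ (y + z) * f (spaceShift y p) ∂κ) - κ.real univ * (ρ y * f (spaceShift y p)) := by
    filter_upwards [h1.prod_right_ae] with y hy
    rw [jumpOp, ← integral_mul_const]
    simp only [sub_mul]
    rw [integral_sub hy (integrable_const _), integral_const, smul_eq_mul]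
  have e2 : ∀ z, ∫ y, ρ (y + z) * f (spaceShift y p) = kcorr volume ρ f (spaceShift (-z) p) := by
    intro z
    rw [kcorr, ← integral_add_right_eq_self
      (fun y => ρ y * f (spaceShift y (spaceShift (-z) p))) z]
    simp only [spaceShift_spaceShift]
    congr 1
    funext y
    congr 2
    abel_nf
  rw [kcorr, integral_congr_ae e, integral_sub h1.integral_prod_left (h2.const_mul _),
    integral_integral_swap h1, integral_const_mul]
  simp only [e2]
  rw [integral_comp_neg_of_symm hκ fun z => kcorr volume ρ f (spaceShift z p)]
  rfl

end Levy

section TimeEnergy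

variable {N : ℕ} {T : ℝ} {κ ν : Measure (Euc N)} {W G Ψ f : Euc N × ℝ → ℝ} {C ε η : ℝ}

/-- The weight `T - t`, truncated outside `[0, T]`. -/
noncomputable def timeWeight (T t : ℝ) : ℝ := max 0 (min (T - t) T)

theorem timeWeight_nonneg (T t : ℝ) : 0 ≤ timeWeight T t := le_max_left _ _

theorem timeWeight_le (hT : 0 ≤ T) (t : ℝ) : timeWeight T t ≤ T :=
  max_le hT (min_le_right _ _)

theorem abs_timeWeight_le (hT : 0 ≤ T) (t : ℝ) : |timeWeight T t| ≤ T := by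
  rw [abs_of_nonneg (timeWeight_nonneg T t)]
  exact timeWeight_le hT t

theorem timeWeight_of_mem {t : ℝ} (ht : t ∈ Ioo 0 T) : timeWeight T t = T - t := by
  rw [timeWeight, min_eq_left (by linarith [ht.1]), max_eq_right (by linarith [ht.2])]

theorem measurable_timeWeight (T : ℝ) : Measurable (timeWeight T) := by
  unfold timeWeight; fun_prop

/-- `p ↦ (T - t) f(p)`. -/
noncomputable def timeWeighted (T : ℝ) (f : Euc N × ℝ → ℝ) (p : Euc N × ℝ) : ℝ :=
  timeWeight T p.2 * f p

theorem measurable_timeWeighted (hf : Measurable f) : Measurable (timeWeighted T f) :=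
  ((measurable_timeWeight T).comp measurable_snd).mul hf

theorem abs_timeWeighted_le (hT : 0 ≤ T) (p : Euc N × ℝ) :
    |timeWeighted T f p| ≤ T * |f p| := by
  rw [timeWeighted, abs_mul]
  exact mul_le_mul_of_nonneg_right (abs_timeWeight_le hT _) (abs_nonneg _)

theorem abs_timeWeighted_le_of_bounded (hT : 0 ≤ T) (hC : ∀ p, |f p| ≤ C) (p : Euc N × ℝ) :
    |timeWeighted T f p| ≤ T * C :=
  (abs_timeWeighted_le hT p).trans (mul_le_mul_of_nonneg_left (hC p) hT)

theorem corr_timeWeighted (p : Euc N × ℝ) :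
    corr κ (timeWeighted T f) p = timeWeight T p.2 * corr κ f p := by
  simp only [corr, timeWeighted, spaceShift]
  exact integral_const_mul _ _

theorem integral_QTvol {f : Euc N × ℝ → ℝ} (hf : Integrable f (QTvol N T)) :
    ∫ p, f p ∂(QTvol N T) = ∫ x, ∫ t in Ioo 0 T, f (x, t) :=
  integral_prod f hf

theorem intervalIntegrable_of_bounded {g : ℝ → ℝ} {C a b : ℝ} (hg : Measurable g)
    (hC : ∀ t, |g t| ≤ C) : IntervalIntegrable g volume a b := by
  rw [intervalIntegrable_iff, uIoc]
  exact Integrable.of_bound hg.aestronglyMeasurable C (Eventually.of_forall hC)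

theorem integral_mul_shift_eq (hT : 0 < T) {CG : ℝ} (hW : Measurable W) (hWC : ∀ p, |W p| ≤ C)
    (hWi : Integrable W (QTvol N T)) (hG : Measurable G) (hGC : ∀ p, |G p| ≤ CG)
    (hWG : ∀ x, ∀ᵐ t ∂volume.restrict (Ioo 0 T), W (x, t) = ∫ s in (0 : ℝ)..t, G (x, s))
    (z : Euc N) :
    ∫ p, W p * W (spaceShift z p) ∂(QTvol N T) =
      ∫ p, timeWeighted T G p * W (spaceShift z p) ∂(QTvol N T) +
        ∫ p, timeWeighted T G (spaceShift z p) * W p ∂(QTvol N T) := by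
  have hH := measurable_timeWeighted (T := T) hG
  have hHC := abs_timeWeighted_le_of_bounded hT.le hGC
  have hWz := integrable_comp_spaceShift z hWi
  have i0 := integrable_mul_of_bounded hW hWC hWz
  have i1 := integrable_mul_of_bounded hH hHC hWz
  have i2 := integrable_mul_of_bounded (hH.comp (measurable_spaceShift z)) (fun _ => hHC _) hWi
  have i3 : Integrable (fun p => timeWeighted T G p * W (spaceShift z p) +
    timeWeighted T G (spaceShift z p) * W p) (QTvol N T) := i1.add i2
  have e := integral_add i1 i2
  simp only [Function.comp_apply] at e
  rw [← e, integral_QTvol i0, integral_QTvol i3]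
  congr 1
  funext x
  have hgx : ∀ y : Euc N, IntervalIntegrable (fun s => G (y, s)) volume 0 T := fun y =>
    intervalIntegrable_of_bounded (hG.comp measurable_prodMk_left) (fun _ => hGC _)
  have key := integral_mul_primitives_eq (hgx x) (hgx (x + z))
  rw [intervalIntegral.integral_of_le hT.le, intervalIntegral.integral_of_le hT.le,
    integral_Ioc_eq_integral_Ioo, integral_Ioc_eq_integral_Ioo] at key
  refine Eq.trans (integral_congr_ae ?_) (key.trans (integral_congr_ae ?_))
  · filter_upwards [hWG x, hWG (x + z)] with t h1 h2
    simp only [spaceShift, h1, h2]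
  · filter_upwards [hWG x, hWG (x + z), ae_restrict_mem measurableSet_Ioo] with t h1 h2 ht
    simp only [spaceShift, h1, h2, timeWeighted, timeWeight_of_mem ht]
    ring

theorem integral_mul_corr_eq_two_mul (hT : 0 < T) [IsFiniteMeasure ν]
    (hν : ν.map (fun z => -z) = ν) {CG : ℝ} (hW : Measurable W) (hWC : ∀ p, |W p| ≤ C)
    (hWi : Integrable W (QTvol N T)) (hG : Measurable G) (hGC : ∀ p, |G p| ≤ CG)
    (hWG : ∀ x, ∀ᵐ t ∂volume.restrict (Ioo 0 T), W (x, t) = ∫ s in (0 : ℝ)..t, G (x, s)) :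
    ∫ p, W p * corr ν W p ∂(QTvol N T) =
      2 * ∫ p, timeWeighted T G p * corr ν W p ∂(QTvol N T) := by
  have hH := measurable_timeWeighted (T := T) hG
  have hHC := abs_timeWeighted_le_of_bounded hT.le hGC
  have a0 := integral_mul_corr (ν := ν) hW hWC hW hWi
  have a1 := integral_mul_corr (ν := ν) hH hHC hW hWi
  have a2 := integral_corr_mul (ν := ν) hH hHC hWi
  have a3 := integral_corr_mul_comm hν hH hHC hW hWi
  rw [a0.2]
  simp only [integral_mul_shift_eq hT hW hWC hWi hG hGC hWG]
  rw [integral_add a1.1.integral_prod_right a2.1.integral_prod_right, ← a1.2, ← a2.2, a3]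
  ring

/-- The energy inequality obtained by testing the evolution with the resolvent of `W`. -/
theorem integral_timeWeighted_mul_le (hT : 0 < T) [IsFiniteMeasure κ] [IsFiniteMeasure ν]
    (hε : 0 < ε) (hκs : κ.map (fun z => -z) = κ) (hνs : ν.map (fun z => -z) = ν)
    (hν1 : ε * ν.real univ = 1)
    (hν : ENNReal.ofReal (ε + κ.real univ) • ν = Measure.dirac 0 + κ.conv ν)
    {CG CΨ : ℝ} (hW : Measurable W) (hWC : ∀ p, |W p| ≤ C)
    (hWi : Integrable W (QTvol N T)) (hG : Measurable G) (hGC : ∀ p, |G p| ≤ CG)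
    (hΨ : Measurable Ψ) (hΨC : ∀ p, |Ψ p| ≤ CΨ)
    (hWG : ∀ x, ∀ᵐ t ∂volume.restrict (Ioo 0 T), W (x, t) = ∫ s in (0 : ℝ)..t, G (x, s))
    (hGΨ : ∀ p, |G p - (corr κ Ψ p - κ.real univ * Ψ p)| ≤ η) :
    ∫ p, timeWeighted T Ψ p * W p ∂(QTvol N T) ≤
      T * ∫ p, |Ψ p| * |ε * corr ν W p| ∂(QTvol N T) +
        T * (η / ε) * ∫ p, |W p| ∂(QTvol N T) := by
  have hη : 0 ≤ η := (abs_nonneg _).trans (hGΨ (0, 0))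
  set Z := corr ν W with hZdef
  have hZ : Measurable Z := measurable_corr hW
  have hZi : Integrable Z (QTvol N T) := integrable_corr hW hWi
  have hres := resolvent_equation hε hν hW hWC
  have hH := measurable_timeWeighted (T := T) hG
  have hHC := abs_timeWeighted_le_of_bounded hT.le hGC
  have hP := measurable_timeWeighted (T := T) hΨ
  have hPC := abs_timeWeighted_le_of_bounded hT.le hΨC
  have hcP := measurable_corr (ν := κ) hP
  have hcPC := abs_corr_le (ν := κ) hP hPC
  have s1 := resolvent_nonneg hε hν hW hWC hWi
  rw [integral_mul_corr_eq_two_mul hT hνs hW hWC hWi hG hGC hWG] at s1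
  have iH := integrable_mul_of_bounded hH hHC hZi
  have iP := integrable_mul_of_bounded hP hPC hZi
  have iW := integrable_mul_of_bounded hP hPC hWi
  have icP := integrable_mul_of_bounded hcP hcPC hZi
  have iA : Integrable (fun p => |Ψ p| * |ε * Z p|) (QTvol N T) :=
    integrable_mul_of_bounded (by fun_prop) (fun p => by rw [abs_abs]; exact hΨC p)
      (hZi.const_mul ε).abs
  have s2 : ∫ p, timeWeighted T G p * Z p ∂(QTvol N T) ≤
      ∫ p, ((corr κ (timeWeighted T Ψ) p * Z p - κ.real univ * (timeWeighted T Ψ p * Z p)) +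
        T * η * |Z p|) ∂(QTvol N T) := by
    refine integral_mono iH ((icP.sub (iP.const_mul _)).add (hZi.abs.const_mul _)) fun p => ?_
    dsimp only
    rw [corr_timeWeighted]
    simp only [timeWeighted]
    have h1 : timeWeight T p.2 * ((G p - (corr κ Ψ p - κ.real univ * Ψ p)) * Z p) ≤
        T * (η * |Z p|) := by
      refine (le_abs_self _).trans ?_
      rw [abs_mul, abs_mul]
      gcongr
      · exact abs_timeWeight_le hT.le _
      · exact hGΨ p
    linarith
  have iS : Integrable (fun p => corr κ (timeWeighted T Ψ) p * Z p -
      κ.real univ * (timeWeighted T Ψ p * Z p)) (QTvol N T) := icP.sub (iP.const_mul _)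
  rw [integral_add iS (hZi.abs.const_mul _), integral_sub icP (iP.const_mul _),
    integral_corr_mul_comm hκs hP hPC hZ hZi, integral_const_mul, integral_const_mul] at s2
  have s3 : ∫ p, timeWeighted T Ψ p * corr κ Z p ∂(QTvol N T) =
      ε * ∫ p, timeWeighted T Ψ p * Z p ∂(QTvol N T) +
        κ.real univ * ∫ p, timeWeighted T Ψ p * Z p ∂(QTvol N T) -
        ∫ p, timeWeighted T Ψ p * W p ∂(QTvol N T) := by
    have iC : Integrable (fun p => (ε + κ.real univ) * (timeWeighted T Ψ p * Z p))
      (QTvol N T) := iP.const_mul _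
    rw [← add_mul, ← integral_const_mul, ← integral_sub iC iW]
    congr 1
    funext p
    linear_combination (- timeWeighted T Ψ p) * hres p
  have s4 : ε * ∫ p, timeWeighted T Ψ p * Z p ∂(QTvol N T) ≤
      T * ∫ p, |Ψ p| * |ε * Z p| ∂(QTvol N T) := by
    rw [← integral_const_mul, ← integral_const_mul]
    refine integral_mono (iP.const_mul _) (iA.const_mul _) fun p => ?_
    have h := abs_timeWeighted_le (f := Ψ) hT.le p
    calc ε * (timeWeighted T Ψ p * Z p) = timeWeighted T Ψ p * (ε * Z p) := by ring
      _ ≤ |timeWeighted T Ψ p| * |ε * Z p| := by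
          rw [← abs_mul]; exact le_abs_self _
      _ ≤ T * |Ψ p| * |ε * Z p| := by gcongr
      _ = T * (|Ψ p| * |ε * Z p|) := by ring
  have s5 : T * η * ∫ p, |Z p| ∂(QTvol N T) ≤ T * (η / ε) * ∫ p, |W p| ∂(QTvol N T) := by
    have h := integral_abs_corr_le (ν := ν) hW hWi
    have e : ν.real univ = 1 / ε := by field_simp; linarith
    rw [e] at h
    calc T * η * ∫ p, |Z p| ∂(QTvol N T) ≤ T * η * (1 / ε * ∫ p, |W p| ∂(QTvol N T)) := by
          gcongr
      _ = _ := by ring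
  linarith

end TimeEnergy

section Core

variable {N : ℕ} {T : ℝ} {μ : Measure (Euc N)} {W Y Ψ Φ U : Euc N × ℝ → ℝ} {ρ : Euc N → ℝ}
  {C : ℝ}

theorem measurableSet_fst_norm_le (R : ℝ) : MeasurableSet {p : Euc N × ℝ | ‖p.1‖ ≤ R} :=
  measurableSet_le (by fun_prop) (by fun_prop)

theorem exists_setIntegral_compl_le (hY : Integrable Y (QTvol N T)) {ω : ℝ} (hω : 0 < ω) :
    ∃ R, ∫ p in {p : Euc N × ℝ | ‖p.1‖ ≤ R}ᶜ, Y p ∂(QTvol N T) ≤ ω := by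
  have hd := tendsto_integral_of_dominated_convergence (μ := QTvol N T)
    (F := fun n : ℕ => indicator {p : Euc N × ℝ | ‖p.1‖ ≤ n}ᶜ Y) (f := fun _ => 0)
    (fun p => ‖Y p‖)
    (fun n => (hY.indicator (measurableSet_fst_norm_le _).compl).aestronglyMeasurable) hY.norm
    (fun n => Eventually.of_forall fun p => norm_indicator_le_norm_self _ _)
    (Eventually.of_forall fun p => ?_)
  · simp only [integral_indicator (measurableSet_fst_norm_le _).compl, integral_zero] at hd
    obtain ⟨n, hn⟩ := (hd.eventually_lt_const hω).exists
    exact ⟨n, hn.le⟩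
  · obtain ⟨n, hn⟩ := exists_nat_ge ‖p.1‖
    refine tendsto_const_nhds.congr' ?_
    filter_upwards [eventually_ge_atTop n] with k hk
    rw [indicator_of_notMem]
    simp only [mem_compl_iff, not_not]
    exact hn.trans (by exact_mod_cast hk)

theorem exists_integral_abs_mul_resolvent_le {c₀ a₀ CY : ℝ} (hc₀ : 0 < c₀) (ha₀ : 0 < a₀)
    (hW : Measurable W) (hWC : ∀ p, |W p| ≤ C) (hWi : Integrable W (QTvol N T))
    (hY : Measurable Y) (hYC : ∀ p, |Y p| ≤ CY) (hYi : Integrable Y (QTvol N T))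
    (hY0 : ∀ p, 0 ≤ Y p) (hΨ : Measurable Ψ) {CΨ : ℝ} (hΨC : ∀ p, |Ψ p| ≤ CΨ)
    (hΨY : ∀ δ > 0, ∃ K ≥ 0, ∀ p, |Ψ p| ≤ δ + K * Y p) {ω : ℝ} (hω : 0 < ω) :
    ∃ ε > 0, ∀ κ ν : Measure (Euc N), IsFiniteMeasure κ → IsFiniteMeasure ν →
      a₀ ≤ κ.real {z | c₀ < ‖z‖} → ε * ν.real univ = 1 →
      ENNReal.ofReal (ε + κ.real univ) • ν = Measure.dirac 0 + κ.conv ν →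
      ∫ p, |Ψ p| * |ε * corr ν W p| ∂(QTvol N T) ≤ ω := by
  have hC0 : 0 ≤ C := (abs_nonneg _).trans (hWC (0, 0))
  have hω4 : 0 < ω / 4 := by positivity
  set w := ∫ p, |W p| ∂(QTvol N T) with hw
  set y := ∫ p, Y p ^ 2 ∂(QTvol N T) with hy
  have hw2 : 0 ≤ ∫ p, W p ^ 2 ∂(QTvol N T) := integral_nonneg fun _ => sq_nonneg _
  obtain ⟨δ, hδ, hδw⟩ := exists_pos_mul_lt hω4 w
  obtain ⟨K, hK0, hK⟩ := hΨY δ hδ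
  obtain ⟨a, ha, hay⟩ := exists_pos_mul_lt hω4 (K * y)
  obtain ⟨b, hb, hbC⟩ := exists_pos_mul_lt hω4 (K * C)
  obtain ⟨R, hR⟩ := exists_setIntegral_compl_le hYi hb
  obtain ⟨η, hη, hηw⟩ := exists_pos_mul_lt hω4
    (K * (1 / (4 * a)) * ∫ p, W p ^ 2 ∂(QTvol N T))
  obtain ⟨ε₀, hε₀, H⟩ := exists_setIntegral_sq_resolvent_le (N := N) (T := T) hc₀ ha₀ R hη
  refine ⟨ε₀ / 2, by positivity, fun κ ν hκf hνf hκa hν1 hν => ?_⟩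
  set ε := ε₀ / 2 with hε
  have hε0 : 0 < ε := by positivity
  have hloc := H ε hε0 (half_lt_self hε₀) κ ν hκf hνf hκa hν W C hW hWC hWi
  set V : Euc N × ℝ → ℝ := fun p => ε * corr ν W p with hVdef
  have hV : Measurable V := (measurable_corr (ν := ν) hW).const_mul ε
  have hVi : Integrable V (QTvol N T) := (integrable_corr (ν := ν) hW hWi).const_mul ε
  have hVC : ∀ p, |V p| ≤ C := fun p => by
    rw [hVdef, abs_mul, abs_of_pos hε0]
    calc ε * |corr ν W p| ≤ ε * (ν.real univ * C) :=
          mul_le_mul_of_nonneg_left (abs_corr_le hW hWC p) hε0.le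
      _ = C := by rw [← mul_assoc, hν1, one_mul]
  have hVw : ∫ p, |V p| ∂(QTvol N T) ≤ w := by
    simp only [hVdef, abs_mul, abs_of_pos hε0]
    rw [integral_const_mul]
    calc ε * ∫ p, |corr ν W p| ∂(QTvol N T) ≤ ε * (ν.real univ * w) :=
          mul_le_mul_of_nonneg_left (integral_abs_corr_le hW hWi) hε0.le
      _ = w := by rw [← mul_assoc, hν1, one_mul]
  have iV2 := integrable_sq_of_bounded hV hVC hVi
  have iY2 := integrable_sq_of_bounded hY hYC hYi
  set B : Set (Euc N × ℝ) := {p | ‖p.1‖ ≤ R} with hB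
  have hBm : MeasurableSet B := measurableSet_fst_norm_le R
  have iΨV : Integrable (fun p => |Ψ p| * |V p|) (QTvol N T) :=
    integrable_mul_of_bounded (by fun_prop) (fun p => by rw [abs_abs]; exact hΨC p) hVi.abs
  have i1 : Integrable (fun p => δ * |V p|) (QTvol N T) := hVi.abs.const_mul δ
  have i2 : Integrable (Bᶜ.indicator fun p => K * C * Y p) (QTvol N T) :=
    (hYi.const_mul _).indicator hBm.compl
  have i3 : Integrable (fun p => K * a * Y p ^ 2) (QTvol N T) := iY2.const_mul _
  have i4 : Integrable (B.indicator fun p => K * (1 / (4 * a)) * V p ^ 2) (QTvol N T) :=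
    (iV2.const_mul _).indicator hBm
  have i12 : Integrable (fun p => δ * |V p| + Bᶜ.indicator (fun p => K * C * Y p) p)
    (QTvol N T) := i1.add i2
  have i34 : Integrable (fun p => K * a * Y p ^ 2 +
    B.indicator (fun p => K * (1 / (4 * a)) * V p ^ 2) p) (QTvol N T) := i3.add i4
  have hpt : ∀ p, |Ψ p| * |V p| ≤ (δ * |V p| + Bᶜ.indicator (fun p => K * C * Y p) p) +
      (K * a * Y p ^ 2 + B.indicator (fun p => K * (1 / (4 * a)) * V p ^ 2) p) := by
    intro p
    have h0 : |Ψ p| * |V p| ≤ δ * |V p| + K * (Y p * |V p|) := by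
      have := mul_le_mul_of_nonneg_right (hK p) (abs_nonneg (V p))
      linarith
    by_cases hp : p ∈ B
    · rw [indicator_of_notMem (notMem_compl_iff.2 hp), indicator_of_mem hp]
      have h1 : Y p * |V p| ≤ a * Y p ^ 2 + 1 / (4 * a) * V p ^ 2 := by
        rw [← sq_abs (V p)]
        have e : a * Y p ^ 2 + 1 / (4 * a) * |V p| ^ 2 - Y p * |V p| =
            (2 * a * Y p - |V p|) ^ 2 / (4 * a) := by
          field_simp; ring
        have : 0 ≤ (2 * a * Y p - |V p|) ^ 2 / (4 * a) := by positivity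
        linarith
      have := mul_le_mul_of_nonneg_left h1 hK0
      linarith
    · rw [indicator_of_mem hp, indicator_of_notMem hp]
      have h1 : Y p * |V p| ≤ C * Y p := by
        rw [mul_comm]; exact mul_le_mul_of_nonneg_right (hVC p) (hY0 p)
      have h2 := mul_le_mul_of_nonneg_left h1 hK0
      have h3 : 0 ≤ K * a * Y p ^ 2 := by positivity
      linarith
  have h := integral_mono iΨV (i12.add i34) hpt
  rw [integral_add' i12 i34, integral_add i1 i2, integral_add i3 i4,
    integral_indicator hBm, integral_indicator hBm.compl, integral_const_mul,
    integral_const_mul, integral_const_mul, integral_const_mul] at h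
  have t1 : δ * ∫ p, |V p| ∂(QTvol N T) ≤ w * δ := by
    rw [mul_comm w]; exact mul_le_mul_of_nonneg_left hVw hδ.le
  have t2 : K * C * ∫ p in Bᶜ, Y p ∂(QTvol N T) ≤ K * C * b :=
    mul_le_mul_of_nonneg_left hR (by positivity)
  have t3 : K * (1 / (4 * a)) * ∫ p in B, V p ^ 2 ∂(QTvol N T) ≤
      K * (1 / (4 * a)) * (η * ∫ p, W p ^ 2 ∂(QTvol N T)) :=
    mul_le_mul_of_nonneg_left hloc (by positivity)
  linarith

theorem IsLevyMeasure.exists_measure_norm_gt_pos (hμ : IsLevyMeasure μ) (h0 : μ ≠ 0) :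
    ∃ c > 0, μ {z | c < ‖z‖} ≠ 0 := by
  by_contra! h
  refine h0 (Measure.measure_univ_eq_zero.1 ?_)
  have hcov : (univ : Set (Euc N)) ⊆ {0} ∪ ⋃ n : ℕ, {z | 1 / ((n : ℝ) + 1) < ‖z‖} := by
    intro z _
    by_cases hz : z = 0
    · exact Or.inl hz
    · obtain ⟨n, hn⟩ := exists_nat_one_div_lt (norm_pos_iff.2 hz)
      exact Or.inr (mem_iUnion.2 ⟨n, hn⟩)
  refine measure_mono_null hcov (measure_union_null hμ.1 (measure_iUnion_null fun n => ?_))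
  exact h _ (by positivity)

theorem abs_kcorr_le_of_abs_le {δ K : ℝ} (hρ : IsTestFn ρ) (hρ0 : ∀ x, 0 ≤ ρ x)
    (hU : Measurable U) (hUC : ∀ p, |U p| ≤ C) (hK : ∀ p, |Φ p| ≤ δ + K * |U p|)
    (p : Euc N × ℝ) :
    |kcorr volume ρ Φ p| ≤ (∫ x, ρ x) * δ + K * kcorr volume ρ (fun p => |U p|) p := by
  have i1 : Integrable (fun z => ρ z * |U (spaceShift z p)|) :=
    integrable_kernel_mul (f := fun p => |U p|) hρ.integrable hU.abs
      (fun p => by rw [abs_abs]; exact hUC p) p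
  have h : |kcorr volume ρ Φ p| ≤ ∫ z, (ρ z * δ + K * (ρ z * |U (spaceShift z p)|)) := by
    refine (abs_integral_le_integral_abs).trans ?_
    refine integral_mono_of_nonneg (Eventually.of_forall fun _ => abs_nonneg _)
      ((hρ.integrable.mul_const δ).add (i1.const_mul K)) (Eventually.of_forall fun z => ?_)
    simp only [abs_mul, abs_of_nonneg (hρ0 z)]
    have := mul_le_mul_of_nonneg_left (hK (spaceShift z p)) (hρ0 z)
    linarith
  rwa [integral_add (hρ.integrable.mul_const δ) (i1.const_mul K), integral_mul_const,
    integral_const_mul] at h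

theorem kcorr_sub_kcorr {k k' : Euc N → ℝ} (hk : Integrable k) (hk' : Integrable k')
    (hΦ : Measurable Φ) (hΦC : ∀ p, |Φ p| ≤ C) (p : Euc N × ℝ) :
    kcorr volume k Φ p - kcorr volume k' Φ p = kcorr volume (fun x => k x - k' x) Φ p := by
  simp only [kcorr, sub_mul]
  rw [integral_sub (integrable_kernel_mul hk hΦ hΦC p) (integrable_kernel_mul hk' hΦ hΦC p)]

theorem integral_timeWeighted_kcorr_mul_nonpos [SFinite μ] (hT : 0 < T) (hμ : IsLevyMeasure μ)
    (hμ0 : μ ≠ 0) (hU : Measurable U) (hUC : ∀ p, |U p| ≤ C) (hUi : Integrable U (QTvol N T))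
    (hΦ : Measurable Φ) {CΦ : ℝ} (hΦC : ∀ p, |Φ p| ≤ CΦ)
    (hΦU : ∀ δ > 0, ∃ K ≥ 0, ∀ p, |Φ p| ≤ δ + K * |U p|)
    (hρ : IsTestFn ρ) (hρ0 : ∀ x, 0 ≤ ρ x)
    (hWG : ∀ x, ∀ᵐ t ∂volume.restrict (Ioo 0 T), kcorr volume ρ U (x, t) =
      ∫ s in (0 : ℝ)..t, kcorr volume (Lop μ ρ) Φ (x, s)) :
    ∫ p, timeWeighted T (kcorr volume ρ Φ) p * kcorr volume ρ U p ∂(QTvol N T) ≤ 0 := by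
  have hρm := hρ.1.continuous.measurable
  have hρi := hρ.integrable
  have hCΦ0 : 0 ≤ CΦ := (abs_nonneg _).trans (hΦC (0, 0))
  have hLm := hρ.measurable_Lop (μ := μ)
  have hLi := hμ.integrable_Lop hρ
  have hI0 : 0 ≤ ∫ x, ρ x := integral_nonneg hρ0
  have hUa : ∀ p, |(fun p => |U p|) p| ≤ C := fun p => by simpa using hUC p
  obtain ⟨c₀, hc₀, hμc⟩ := hμ.exists_measure_norm_gt_pos hμ0
  set a₀ := μ.real {z | c₀ < ‖z‖} with ha₀def
  have ha₀ : 0 < a₀ := ENNReal.toReal_pos hμc (hμ.measure_norm_gt_lt_top hc₀).ne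
  have hW := measurable_kcorr (ν := volume) hρm hU
  have hWC := abs_kcorr_le hρi hU hUC
  have hWi := integrable_kcorr hρm hρi hU hUi
  have hΨ := measurable_kcorr (ν := volume) hρm hΦ
  have hΨC := abs_kcorr_le hρi hΦ hΦC
  have hG := measurable_kcorr (ν := volume) hLm hΦ
  have hGC := abs_kcorr_le hLi hΦ hΦC
  have hΨY : ∀ δ > 0, ∃ K ≥ 0, ∀ p, |kcorr volume ρ Φ p| ≤
      δ + K * kcorr volume ρ (fun p => |U p|) p := by
    intro δ hδ
    obtain ⟨δ', hδ', hδ''⟩ := exists_pos_mul_lt hδ (∫ x, ρ x)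
    obtain ⟨K, hK0, hK⟩ := hΦU δ' hδ'
    refine ⟨K, hK0, fun p => (abs_kcorr_le_of_abs_le hρ hρ0 hU hUC hK p).trans ?_⟩
    linarith
  refine le_of_forall_pos_le_add fun ω hω => ?_
  obtain ⟨ω', hω', hTω⟩ := exists_pos_mul_lt (half_pos hω) T
  obtain ⟨ε, hε, H⟩ := exists_integral_abs_mul_resolvent_le hc₀ ha₀ hW hWC hWi
    (measurable_kcorr (ν := volume) hρm hU.abs) (abs_kcorr_le hρi hU.abs hUa)
    (integrable_kcorr hρm hρi hU.abs hUi.abs)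
    (fun p => integral_nonneg fun z => mul_nonneg (hρ0 z) (abs_nonneg _)) hΨ hΨC hΨY hω'
  set w := ∫ p, |kcorr volume ρ U p| ∂(QTvol N T) with hw
  have hw0 : 0 ≤ w := integral_nonneg fun _ => abs_nonneg _
  obtain ⟨η, hη, hηw⟩ := exists_pos_mul_lt (half_pos hω) (T * (CΦ / ε) * w)
  obtain ⟨r, hr, hrc, hrη⟩ := hμ.exists_integral_abs_Lop_sub_le hρ hη hc₀
  have hκf := hμ.isFiniteMeasure_restrict hr
  have hκs := hμ.map_neg_restrict r
  set κ := μ.restrict {z | r < ‖z‖} with hκ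
  have hκa : a₀ ≤ κ.real {z | c₀ < ‖z‖} := by
    rw [hκ, measureReal_restrict_apply (measurableSet_norm_gt c₀), inter_eq_left.2]
    exact fun z (hz : c₀ < ‖z‖) => hrc.trans hz
  obtain ⟨ν, hνf, hνs, hν1, hν⟩ := exists_resolvent_measure κ hκs hε
  have hGΨ : ∀ p, |kcorr volume (Lop μ ρ) Φ p -
      (corr κ (kcorr volume ρ Φ) p - κ.real univ * kcorr volume ρ Φ p)| ≤ η * CΦ := by
    intro p
    rw [← kcorr_jumpOp hκs hρ hΦ hΦC, kcorr_sub_kcorr hLi (integrable_jumpOp hρ) hΦ hΦC]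
    exact (abs_kcorr_le (hLi.sub (integrable_jumpOp hρ)) hΦ hΦC p).trans
      (mul_le_mul_of_nonneg_right hrη hCΦ0)
  have hfin := integral_timeWeighted_mul_le hT hε hκs hνs hν1 hν hW hWC hWi hG hGC hΨ hΨC hWG hGΨ
  have hA := mul_le_mul_of_nonneg_left (H κ ν hκf hνf hκa hν1 hν) hT.le
  have e : T * (η * CΦ / ε) * w = T * (CΦ / ε) * w * η := by ring
  rw [← hw, e] at hfin
  linarith

end Core

section Mollifier

variable {N : ℕ} {T : ℝ} {Φ U f : Euc N × ℝ → ℝ} {C : ℝ}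

/-- A bump function supported in a ball of radius `2 / (n + 1)`. -/
noncomputable def mollifierBump (N n : ℕ) : ContDiffBump (0 : Euc N) where
  rIn := 1 / ((n : ℝ) + 1)
  rOut := 2 * (1 / ((n : ℝ) + 1))
  rIn_pos := by positivity
  rIn_lt_rOut := by
    have : 0 < 1 / ((n : ℝ) + 1) := by positivity
    linarith

/-- The standard sequence of mollifiers. -/
noncomputable def mollifier (N n : ℕ) : Euc N → ℝ := (mollifierBump N n).normed volume

theorem isTestFn_mollifier (N n : ℕ) : IsTestFn (mollifier N n) :=
  ⟨(mollifierBump N n).contDiff_normed, (mollifierBump N n).hasCompactSupport_normed⟩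

theorem mollifier_nonneg (N n : ℕ) (x : Euc N) : 0 ≤ mollifier N n x :=
  (mollifierBump N n).nonneg_normed x

theorem integral_mollifier (N n : ℕ) : ∫ x, mollifier N n x = 1 :=
  (mollifierBump N n).integral_normed

theorem measurable_mollifier (N n : ℕ) : Measurable (mollifier N n) :=
  (isTestFn_mollifier N n).1.continuous.measurable

theorem ae_tendsto_kcorr_mollifier (hf : Measurable f) (hC : ∀ p, |f p| ≤ C) :
    ∀ᵐ p ∂(QTvol N T), Tendsto (fun n => kcorr volume (mollifier N n) f p) atTop (nhds (f p)) := by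
  have hm : MeasurableSet {p | Tendsto (fun n => kcorr volume (mollifier N n) f p - f p)
      atTop (nhds 0)} := measurableSet_tendsto _ fun n =>
    (measurable_kcorr (measurable_mollifier N n) hf).sub hf
  suffices h : ∀ᵐ p ∂(QTvol N T), Tendsto (fun n => kcorr volume (mollifier N n) f p - f p)
      atTop (nhds 0) from h.mono fun p hp => tendsto_sub_nhds_zero_iff.1 hp
  rw [QTvol, Measure.ae_prod_iff_ae_ae hm]
  refine (Measure.ae_ae_comm (p := fun x t => Tendsto (fun n =>
    kcorr volume (mollifier N n) f (x, t) - f (x, t)) atTop (nhds 0)) hm).2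
    (Eventually.of_forall fun t => ?_)
  have hloc : LocallyIntegrable (fun x => f (x, t)) (volume : Measure (Euc N)) :=
    (locallyIntegrable_const C).mono (hf.comp measurable_prodMk_right).aestronglyMeasurable
      (Eventually.of_forall fun x => (hC _).trans (le_abs_self C))
  have hr : Tendsto (fun n => (mollifierBump N n).rOut) atTop (nhds 0) := by
    have := tendsto_one_div_add_atTop_nhds_zero_nat (𝕜 := ℝ).const_mul 2
    rwa [mul_zero] at this
  filter_upwards [ContDiffBump.ae_convolution_tendsto_right_of_locallyIntegrable
    (φ := mollifierBump N) (K := 2) hr (Eventually.of_forall fun n => le_rfl) hloc] with x hx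
  refine tendsto_sub_nhds_zero_iff.2 (hx.congr fun n => ?_)
  rw [convolution_def, ← integral_neg_eq_self]
  simp only [ContDiffBump.normed_neg, sub_neg_eq_add, ContinuousLinearMap.lsmul_apply,
    smul_eq_mul]
  rfl

theorem integral_timeWeighted_mul_nonpos_of_mollifier (hT : 0 < T)
    (hU : Measurable U) (hUC : ∀ p, |U p| ≤ C) (hUi : Integrable U (QTvol N T))
    (hΦ : Measurable Φ) {CΦ : ℝ} (hΦC : ∀ p, |Φ p| ≤ CΦ)
    (h : ∀ n, ∫ p, timeWeighted T (kcorr volume (mollifier N n) Φ) p *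
      kcorr volume (mollifier N n) U p ∂(QTvol N T) ≤ 0) :
    ∫ p, timeWeighted T Φ p * U p ∂(QTvol N T) ≤ 0 := by
  have hUa : ∀ p, |(fun p => |U p|) p| ≤ C := fun p => by simpa using hUC p
  have hCΦ0 : 0 ≤ CΦ := (abs_nonneg _).trans (hΦC (0, 0))
  set Y : ℕ → Euc N × ℝ → ℝ := fun n => kcorr volume (mollifier N n) fun p => |U p| with hYdef
  set W : ℕ → Euc N × ℝ → ℝ := fun n => kcorr volume (mollifier N n) U with hWdef
  set Ψ : ℕ → Euc N × ℝ → ℝ := fun n => kcorr volume (mollifier N n) Φ with hΨdef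
  have hρi : ∀ n, Integrable (mollifier N n) := fun n => (isTestFn_mollifier N n).integrable
  have hρ1 : ∀ n, ∫ z, |mollifier N n z| = 1 := fun n => by
    simp only [abs_of_nonneg (mollifier_nonneg N n _), integral_mollifier]
  have hΨC : ∀ n p, |Ψ n p| ≤ CΦ := fun n p => by
    have := abs_kcorr_le (hρi n) hΦ hΦC p
    rwa [hρ1, one_mul] at this
  have hΨm : ∀ n, Measurable (Ψ n) := fun n => measurable_kcorr (measurable_mollifier N n) hΦ
  have hWm : ∀ n, Measurable (W n) := fun n => measurable_kcorr (measurable_mollifier N n) hU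
  have hYm : ∀ n, Measurable (Y n) := fun n => measurable_kcorr (measurable_mollifier N n) hU.abs
  have hWi : ∀ n, Integrable (W n) (QTvol N T) := fun n =>
    integrable_kcorr (measurable_mollifier N n) (hρi n) hU hUi
  have hYi : ∀ n, Integrable (Y n) (QTvol N T) := fun n =>
    integrable_kcorr (measurable_mollifier N n) (hρi n) hU.abs hUi.abs
  have hYint : ∀ n, ∫ p, Y n p ∂(QTvol N T) = ∫ p, |U p| ∂(QTvol N T) := fun n => by
    rw [hYdef, integral_kcorr (measurable_mollifier N n) (hρi n) hU.abs hUi.abs,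
      integral_mollifier, one_mul]
  have hWY : ∀ n p, |W n p| ≤ Y n p := fun n p => by
    refine (abs_integral_le_integral_abs).trans (le_of_eq ?_)
    simp only [abs_mul, abs_of_nonneg (mollifier_nonneg N n _), hYdef, kcorr]
  have iΨW : ∀ n, Integrable (fun p => timeWeighted T (Ψ n) p * W n p) (QTvol N T) := fun n =>
    integrable_mul_of_bounded (measurable_timeWeighted (hΨm n))
      (abs_timeWeighted_le_of_bounded hT.le (hΨC n)) (hWi n)
  have iΦU : Integrable (fun p => timeWeighted T Φ p * U p) (QTvol N T) :=
    integrable_mul_of_bounded (measurable_timeWeighted hΦ)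
      (abs_timeWeighted_le_of_bounded hT.le hΦC) hUi
  set F : ℕ → Euc N × ℝ → ℝ := fun n p => T * CΦ * Y n p + timeWeighted T (Ψ n) p * W n p with hF
  have hFi : ∀ n, Integrable (F n) (QTvol N T) := fun n => ((hYi n).const_mul _).add (iΨW n)
  have hbd : ∀ a b c : ℝ, |a| ≤ T * CΦ → |b| ≤ c → 0 ≤ T * CΦ * c + a * b := by
    intro a b c ha hb
    have h1 : |a * b| ≤ T * CΦ * c := by
      rw [abs_mul]; exact mul_le_mul ha hb (abs_nonneg _) (by positivity)
    linarith [neg_abs_le (a * b)]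
  have hF0 : ∀ n p, 0 ≤ F n p := fun n p =>
    hbd _ _ _ (abs_timeWeighted_le_of_bounded hT.le (hΨC n) p) (hWY n p)
  have hlimi : Integrable (fun p => T * CΦ * |U p| + timeWeighted T Φ p * U p) (QTvol N T) :=
    (hUi.abs.const_mul _).add iΦU
  have hlim0 : ∀ p, 0 ≤ T * CΦ * |U p| + timeWeighted T Φ p * U p := fun p =>
    hbd _ _ _ (abs_timeWeighted_le_of_bounded hT.le hΦC p) le_rfl
  have hFint : ∀ n, ∫ p, F n p ∂(QTvol N T) ≤ T * CΦ * ∫ p, |U p| ∂(QTvol N T) := fun n => by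
    rw [hF, integral_add ((hYi n).const_mul _) (iΨW n), integral_const_mul, hYint]
    linarith [h n]
  have hA0 : 0 ≤ T * CΦ * ∫ p, |U p| ∂(QTvol N T) :=
    mul_nonneg (by positivity) (integral_nonneg fun _ => abs_nonneg _)
  have hfatou : ∫⁻ p, ENNReal.ofReal (T * CΦ * |U p| + timeWeighted T Φ p * U p) ∂(QTvol N T) ≤
      ENNReal.ofReal (T * CΦ * ∫ p, |U p| ∂(QTvol N T)) := by
    calc ∫⁻ p, ENNReal.ofReal (T * CΦ * |U p| + timeWeighted T Φ p * U p) ∂(QTvol N T)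
        = ∫⁻ p, liminf (fun n => ENNReal.ofReal (F n p)) atTop ∂(QTvol N T) := by
          refine lintegral_congr_ae ?_
          filter_upwards [ae_tendsto_kcorr_mollifier (T := T) hU hUC,
            ae_tendsto_kcorr_mollifier (T := T) hΦ hΦC,
            ae_tendsto_kcorr_mollifier (T := T) hU.abs hUa] with p h1 h2 h3
          refine (Tendsto.liminf_eq ?_).symm
          refine (ENNReal.continuous_ofReal.tendsto _).comp ?_
          exact (h3.const_mul _).add ((h2.const_mul _).mul h1)
      _ ≤ liminf (fun n => ∫⁻ p, ENNReal.ofReal (F n p) ∂(QTvol N T)) atTop :=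
          lintegral_liminf_le fun n => (((hYm n).const_mul _).add
            ((measurable_timeWeighted (hΨm n)).mul (hWm n))).ennreal_ofReal
      _ ≤ liminf (fun _ : ℕ => ENNReal.ofReal (T * CΦ * ∫ p, |U p| ∂(QTvol N T))) atTop := by
          refine liminf_le_liminf (Eventually.of_forall fun n => ?_)
          rw [← ofReal_integral_eq_lintegral_ofReal (hFi n) (Eventually.of_forall (hF0 n))]
          exact ENNReal.ofReal_le_ofReal (hFint n)
      _ = _ := liminf_const _
  rw [← ofReal_integral_eq_lintegral_ofReal hlimi (Eventually.of_forall hlim0),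
    ENNReal.ofReal_le_ofReal_iff hA0, integral_add (hUi.abs.const_mul _) iΦU,
    integral_const_mul] at hfatou
  linarith

end Mollifier

section Main

variable {N : ℕ} {T : ℝ} {μ : Measure (Euc N)} {U Φ : Euc N × ℝ → ℝ} {ρ : Euc N → ℝ} {C : ℝ}

theorem MemLinfQT.exists_bounded_representative {u : Euc N → ℝ → ℝ} (hu : MemLinfQT T u) :
    ∃ (g : Euc N × ℝ → ℝ) (C : ℝ), Measurable g ∧ (∀ p, |g p| ≤ C) ∧
      ∀ᵐ p ∂(QTvol N T), u p.1 p.2 = g p := by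
  obtain ⟨hm, C, hC⟩ := hu
  refine ⟨fun p => max (-|C|) (min |C| (hm.mk _ p)), |C|, ?_, fun p => ?_, ?_⟩
  · exact measurable_const.max (measurable_const.min hm.stronglyMeasurable_mk.measurable)
  · rw [abs_le]
    exact ⟨le_max_left _ _, max_le (by linarith [abs_nonneg C]) (min_le_left _ _)⟩
  · filter_upwards [hm.ae_eq_mk, hC] with p h1 h2
    have h3 := abs_le.1 (h2.trans (le_abs_self C))
    rw [← h1, min_eq_right h3.2, max_eq_right h3.1]

theorem isSTTestFn_mul {θ : ℝ → ℝ} (hρ : IsTestFn ρ) (hθ : ContDiff ℝ (⊤ : ℕ∞) θ)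
    (hθc : HasCompactSupport θ) (hθT : tsupport θ ⊆ Iio T) (x : Euc N) :
    IsSTTestFn T fun y t => ρ (y - x) * θ t := by
  have hsub : Function.support (Function.uncurry fun y t => ρ (y - x) * θ t) ⊆
      ((fun y => y + x) '' tsupport ρ) ×ˢ tsupport θ := by
    rintro ⟨y, t⟩ h
    simp only [Function.mem_support, Function.uncurry_apply_pair] at h
    refine ⟨⟨y - x, subset_tsupport _ (left_ne_zero_of_mul h), by simp⟩,
      subset_tsupport _ (right_ne_zero_of_mul h)⟩
  have hK : IsCompact (((fun y => y + x) '' tsupport ρ) ×ˢ tsupport θ) :=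
    (hρ.2.isCompact.image (by fun_prop)).prod hθc.isCompact
  refine ⟨?_, HasCompactSupport.of_support_subset_isCompact hK hsub, ?_⟩
  · exact (hρ.1.comp (contDiff_fst.sub contDiff_const)).mul (hθ.comp contDiff_snd)
  · exact (closure_minimal hsub hK.isClosed).trans fun p hp => hθT hp.2

theorem Lop_comp_sub_mul (hρ : IsTestFn ρ) (x : Euc N) (a : ℝ) (y : Euc N) :
    Lop μ (fun y => ρ (y - x) * a) y = Lop μ ρ (y - x) * a := by
  have hd : fderiv ℝ (fun y => ρ (y - x) * a) y = a • fderiv ℝ ρ (y - x) := by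
    have hd : DifferentiableAt ℝ (fun y => ρ (y - x)) y :=
      ((hρ.1.differentiable (by simp)).differentiableAt (x := y - x)).comp y
        (differentiableAt_id.sub_const x)
    rw [fderiv_mul_const hd, fderiv_comp_sub]
  simp only [Lop, ← integral_mul_const, hd]
  congr 1
  funext z
  rw [add_sub_right_comm]
  split_ifs <;> simp <;> ring

theorem integral_mollified_weak_eq [SFinite μ] (hμ : IsLevyMeasure μ) {w g : Euc N → ℝ → ℝ}
    (hU : Measurable U) (hUC : ∀ p, |U p| ≤ C) (hΦ : Measurable Φ) {CΦ : ℝ}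
    (hΦC : ∀ p, |Φ p| ≤ CΦ) (hw : ∀ᵐ p ∂(QTvol N T), w p.1 p.2 = U p)
    (hg : ∀ᵐ p ∂(QTvol N T), g p.1 p.2 = Φ p)
    (heq : ∀ ψ : Euc N → ℝ → ℝ, IsSTTestFn T ψ → ∫ t in Ioo (0 : ℝ) T, ∫ x,
      (w x t * deriv (ψ x) t + g x t * Lop μ (fun y => ψ y t) x) = 0)
    (hρ : IsTestFn ρ) {θ : ℝ → ℝ} (hθ : ContDiff ℝ (⊤ : ℕ∞) θ)
    (hθc : HasCompactSupport θ) (hθT : tsupport θ ⊆ Iio T) (x : Euc N) :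
    ∫ t in Ioo 0 T, (kcorr volume ρ U (x, t) * deriv θ t +
      kcorr volume (Lop μ ρ) Φ (x, t) * θ t) = 0 := by
  refine Eq.trans ?_ (heq _ (isSTTestFn_mul hρ hθ hθc hθT x))
  have hae : ∀ᵐ t ∂volume.restrict (Ioo 0 T), ∀ᵐ y : Euc N, w y t = U (y, t) ∧
      g y t = Φ (y, t) := by
    have h := hw.and hg
    rw [QTvol, ← Measure.prod_swap] at h
    exact Measure.ae_ae_of_ae_prod (ae_of_ae_map measurable_swap.aemeasurable h)
  refine integral_congr_ae ?_
  filter_upwards [hae] with t ht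
  have e : ∫ y, (w y t * deriv (fun t => ρ (y - x) * θ t) t +
      g y t * Lop μ (fun y => ρ (y - x) * θ t) y) =
      ∫ y, (ρ (y - x) * U (y, t) * deriv θ t + Lop μ ρ (y - x) * Φ (y, t) * θ t) := by
    refine integral_congr_ae ?_
    filter_upwards [ht] with y hy
    rw [hy.1, hy.2, Lop_comp_sub_mul hρ,
      deriv_const_mul _ ((hθ.differentiable (by simp)).differentiableAt)]
    ring
  rw [e, ← integral_add_right_eq_self
    (fun y => ρ (y - x) * U (y, t) * deriv θ t + Lop μ ρ (y - x) * Φ (y, t) * θ t) x]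
  simp only [add_sub_cancel_right]
  have i1 : Integrable (fun z => ρ z * U (z + x, t)) := by
    simpa only [spaceShift, add_comm x] using integrable_kernel_mul hρ.integrable hU hUC (x, t)
  have i2 : Integrable (fun z => Lop μ ρ z * Φ (z + x, t)) := by
    simpa only [spaceShift, add_comm x] using
      integrable_kernel_mul (hμ.integrable_Lop hρ) hΦ hΦC (x, t)
  rw [integral_add (i1.mul_const _) (i2.mul_const _), integral_mul_const, integral_mul_const]
  simp only [kcorr, spaceShift, add_comm x]

theorem ae_kcorr_eq_primitive [SFinite μ] (hT : 0 < T) (hμ : IsLevyMeasure μ)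
    {w g : Euc N → ℝ → ℝ}
    (hU : Measurable U) (hUC : ∀ p, |U p| ≤ C) (hΦ : Measurable Φ) {CΦ : ℝ}
    (hΦC : ∀ p, |Φ p| ≤ CΦ) (hw : ∀ᵐ p ∂(QTvol N T), w p.1 p.2 = U p)
    (hg : ∀ᵐ p ∂(QTvol N T), g p.1 p.2 = Φ p)
    (heq : ∀ ψ : Euc N → ℝ → ℝ, IsSTTestFn T ψ → ∫ t in Ioo (0 : ℝ) T, ∫ x,
      (w x t * deriv (ψ x) t + g x t * Lop μ (fun y => ψ y t) x) = 0)
    (hρ : IsTestFn ρ) (x : Euc N) :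
    ∀ᵐ t ∂volume.restrict (Ioo 0 T), kcorr volume ρ U (x, t) =
      ∫ s in (0 : ℝ)..t, kcorr volume (Lop μ ρ) Φ (x, s) := by
  have hρm := hρ.1.continuous.measurable
  refine ae_eq_primitive_of_weak_deriv hT ?_ ?_ fun θ hθ hθc hθT =>
    integral_mollified_weak_eq hμ hU hUC hΦ hΦC hw hg heq hρ hθ hθc hθT x
  · exact Integrable.of_bound ((measurable_kcorr hρm hU).comp
      measurable_prodMk_left).aestronglyMeasurable _
      (Eventually.of_forall fun t => abs_kcorr_le hρ.integrable hU hUC (x, t))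
  · exact Integrable.of_bound ((measurable_kcorr (hρ.measurable_Lop (μ := μ)) hΦ).comp
      measurable_prodMk_left).aestronglyMeasurable _
      (Eventually.of_forall fun t => abs_kcorr_le (hμ.integrable_Lop hρ) hΦ hΦC (x, t))

theorem ae_eq_zero_of_ae_kcorr_Lop_eq_zero
    (hU : Measurable U) (hUC : ∀ p, |U p| ≤ C)
    (hWG : ∀ n x, ∀ᵐ t ∂volume.restrict (Ioo 0 T), kcorr volume (mollifier N n) U (x, t) =
      ∫ s in (0 : ℝ)..t, kcorr volume (Lop μ (mollifier N n)) Φ (x, s))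
    (hG : ∀ n, ∀ᵐ p ∂(QTvol N T), kcorr volume (Lop μ (mollifier N n)) Φ p = 0) :
    ∀ᵐ p ∂(QTvol N T), U p = 0 := by
  have hW : ∀ n, ∀ᵐ p ∂(QTvol N T), kcorr volume (mollifier N n) U p = 0 := by
    intro n
    have hm : MeasurableSet {p | kcorr volume (mollifier N n) U p = 0} :=
      measurableSet_eq_fun (measurable_kcorr (measurable_mollifier N n) hU) measurable_const
    rw [QTvol, Measure.ae_prod_iff_ae_ae hm]
    filter_upwards [Measure.ae_ae_of_ae_prod (hG n)] with x hx
    filter_upwards [hWG n x, ae_restrict_mem measurableSet_Ioo] with t ht htT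
    rw [ht, intervalIntegral.integral_of_le htT.1.le, integral_Ioc_eq_integral_Ioo]
    refine integral_eq_zero_of_ae ?_
    exact ae_mono (Measure.restrict_mono (Ioo_subset_Ioo_right htT.2.le) le_rfl) hx
  filter_upwards [ae_all_iff.2 hW, ae_tendsto_kcorr_mollifier (T := T) hU hUC] with p h1 h2
  simp only [h1] at h2
  exact tendsto_nhds_unique h2 tendsto_const_nhds

theorem exists_abs_sub_le_add_mul {φ : ℝ → ℝ} (hφ : Continuous φ) (C : ℝ) {δ : ℝ} (hδ : 0 < δ) :
    ∃ K ≥ 0, ∀ a b, |a| ≤ C → |b| ≤ C → |φ a - φ b| ≤ δ + K * |a - b| := by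
  have hc : IsCompact (Icc (-C) C) := isCompact_Icc
  obtain ⟨M, hM⟩ := hc.exists_bound_of_continuousOn hφ.continuousOn
  obtain ⟨γ, hγ, hu⟩ := Metric.uniformContinuousOn_iff.1
    (hc.uniformContinuousOn_of_continuous hφ.continuousOn) δ hδ
  refine ⟨2 * |M| / γ, by positivity, fun a b ha hb => ?_⟩
  have ha' := abs_le.1 ha
  have hb' := abs_le.1 hb
  rcases lt_or_ge |a - b| γ with h | h
  · have h1 := hu a ha' b hb' h
    rw [Real.dist_eq] at h1
    have : 0 ≤ 2 * |M| / γ * |a - b| := by positivity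
    linarith
  · have h1 : |φ a - φ b| ≤ 2 * |M| := by
      refine (abs_sub _ _).trans ?_
      have h2 := (hM a ha').trans (le_abs_self M)
      have h3 := (hM b hb').trans (le_abs_self M)
      rw [Real.norm_eq_abs] at h2 h3
      linarith
    have h2 : 2 * |M| ≤ 2 * |M| / γ * |a - b| := by
      rw [div_mul_eq_mul_div, le_div_iff₀ hγ]
      gcongr
    linarith

end Main

/-- Uniqueness of bounded distributional solutions (Theorem 2.2 / `uniqueness`).
If `u, û ∈ L^∞(Q_T)`, `u − û ∈ L¹(Q_T)` and `u, û` solve the equation with the same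
distributional initial trace (encoded by the single integral identity against all
test functions `ψ ∈ C_c^∞(ℝ^N × [0,T))`), then `u = û` a.e. in `Q_T`. -/
theorem uniqueness_of_bounded_distributional_solutions
    (N : ℕ) (hN : 0 < N) (T : ℝ) (hT : 0 < T)
    (φ : ℝ → ℝ) (hφc : Continuous φ) (hφm : Monotone φ)
    (μ : Measure (Euc N)) (hμ : IsLevyMeasure μ)
    (u v : Euc N → ℝ → ℝ)
    (hu : MemLinfQT T u) (hv : MemLinfQT T v)
    (huv : MemL1QT T (fun x t => u x t - v x t))
    (heq : ∀ ψ : Euc N → ℝ → ℝ, IsSTTestFn T ψ →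
      ∫ t in Set.Ioo (0 : ℝ) T, ∫ x,
        ((u x t - v x t) * deriv (ψ x) t
          + (φ (u x t) - φ (v x t)) * Lop μ (fun y => ψ y t) x) = 0) :
    ∀ᵐ p ∂(QTvol N T), u p.1 p.2 = v p.1 p.2 := by
  have hσ := hμ.sigmaFinite
  obtain ⟨a, A, ha, haA, hua⟩ := hu.exists_bounded_representative
  obtain ⟨b, B, hb, hbB, hvb⟩ := hv.exists_bounded_representative
  set U : Euc N × ℝ → ℝ := fun p => a p - b p with hUdef
  set Φ : Euc N × ℝ → ℝ := fun p => φ (a p) - φ (b p) with hΦdef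
  have hU : Measurable U := ha.sub hb
  have hΦ : Measurable Φ := (hφc.measurable.comp ha).sub (hφc.measurable.comp hb)
  have hUC : ∀ p, |U p| ≤ A + B := fun p => (abs_sub _ _).trans (add_le_add (haA p) (hbB p))
  have hUae : ∀ᵐ p ∂(QTvol N T), u p.1 p.2 - v p.1 p.2 = U p := by
    filter_upwards [hua, hvb] with p h1 h2
    rw [h1, h2]
  have hΦae : ∀ᵐ p ∂(QTvol N T), φ (u p.1 p.2) - φ (v p.1 p.2) = Φ p := by
    filter_upwards [hua, hvb] with p h1 h2
    rw [h1, h2]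
  have hUi : Integrable U (QTvol N T) := Integrable.congr huv hUae
  have hΦU : ∀ δ > 0, ∃ K ≥ 0, ∀ p, |Φ p| ≤ δ + K * |U p| := by
    intro δ hδ
    obtain ⟨K, hK0, hK⟩ := exists_abs_sub_le_add_mul hφc (max A B) hδ
    exact ⟨K, hK0, fun p => hK _ _ ((haA p).trans (le_max_left _ _))
      ((hbB p).trans (le_max_right _ _))⟩
  obtain ⟨CΦ, hΦC⟩ : ∃ CΦ, ∀ p, |Φ p| ≤ CΦ := by
    obtain ⟨K, hK0, hK⟩ := hΦU 1 one_pos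
    exact ⟨1 + K * (A + B), fun p => (hK p).trans
      (add_le_add_right (mul_le_mul_of_nonneg_left (hUC p) hK0) 1)⟩
  have hWG : ∀ n x, ∀ᵐ t ∂volume.restrict (Ioo 0 T), kcorr volume (mollifier N n) U (x, t) =
      ∫ s in (0 : ℝ)..t, kcorr volume (Lop μ (mollifier N n)) Φ (x, s) := fun n x =>
    ae_kcorr_eq_primitive hT hμ hU hUC hΦ hΦC hUae hΦae heq (isTestFn_mollifier N n) x
  suffices hG : ∀ n, ∀ᵐ p ∂(QTvol N T), kcorr volume (Lop μ (mollifier N n)) Φ p = 0 by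
    filter_upwards [ae_eq_zero_of_ae_kcorr_Lop_eq_zero hU hUC hWG hG, hUae] with p h1 h2
    linarith
  intro n
  by_cases hμ0 : μ = 0
  · refine Eventually.of_forall fun p => ?_
    simp [kcorr, Lop, hμ0]
  have hΦU0 : ∀ p, 0 ≤ Φ p * U p := fun p => by
    rcases le_total (a p) (b p) with h | h
    · exact mul_nonneg_of_nonpos_of_nonpos (sub_nonpos.2 (hφm h)) (sub_nonpos.2 h)
    · exact mul_nonneg (sub_nonneg.2 (hφm h)) (sub_nonneg.2 h)
  have hle := integral_timeWeighted_mul_nonpos_of_mollifier hT hU hUC hUi hΦ hΦC fun n =>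
    integral_timeWeighted_kcorr_mul_nonpos hT hμ hμ0 hU hUC hUi hΦ hΦC hΦU
      (isTestFn_mollifier N n) (mollifier_nonneg N n) (hWG n)
  have hnn : ∀ p, 0 ≤ timeWeighted T Φ p * U p := fun p => by
    rw [timeWeighted, mul_assoc]
    exact mul_nonneg (timeWeight_nonneg _ _) (hΦU0 p)
  have hz := (integral_eq_zero_iff_of_nonneg hnn (integrable_mul_of_bounded
    (measurable_timeWeighted hΦ) (abs_timeWeighted_le_of_bounded hT.le hΦC) hUi)).1
    (le_antisymm hle (integral_nonneg hnn))
  have htime : ∀ᵐ p ∂(QTvol N T), p.2 ∈ Ioo 0 T :=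
    Measure.quasiMeasurePreserving_snd.ae (ae_restrict_mem measurableSet_Ioo)
  have hΦ0 : ∀ᵐ p ∂(QTvol N T), Φ p = 0 := by
    filter_upwards [hz, htime] with p h1 h2
    simp only [timeWeighted, timeWeight_of_mem h2, Pi.zero_apply, mul_eq_zero, or_assoc] at h1
    rcases h1 with h | h | h
    · linarith [h2.2]
    · exact h
    · simp only [hΦdef, sub_eq_zero.1 h, sub_self]
  have hΦi : Integrable Φ (QTvol N T) :=
    (integrable_zero _ _ _).congr (hΦ0.mono fun p hp => hp.symm)
  have hLm := (isTestFn_mollifier N n).measurable_Lop (μ := μ)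
  have hLi := hμ.integrable_Lop (isTestFn_mollifier N n)
  have h1 := integral_abs_kcorr_le hLm hLi hΦ hΦi
  have h2 : ∫ p, |Φ p| ∂(QTvol N T) = 0 :=
    integral_eq_zero_of_ae (hΦ0.mono fun p hp => by simp [hp])
  rw [h2, mul_zero] at h1
  have h3 := (integral_eq_zero_iff_of_nonneg (fun p => abs_nonneg _)
    (integrable_kcorr hLm hLi hΦ hΦi).abs).1
    (le_antisymm h1 (integral_nonneg fun _ => abs_nonneg _))
  exact h3.mono fun p hp => abs_eq_zero.1 hp
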